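/- arXiv:2603.23139 — 4 statements merged into one kernel-verified Lean document; each statement's English description precedes it below -/
import Mathlib

section
/- Let G be a graph and suppose that every proper edge-precoloring of at most k edges of G can be extended to a proper edge-coloring of G with l colors. Then for every integer m ≥ 0, every proper edge-precoloring of at most k+m edges of G can be extended to a proper edge-coloring of G with l+m colors. -/
open SimpleGraph

/-- A (partial) edge-coloring `C` is proper on the edge set `E₀`:
any two distinct edges of `E₀` sharing an endpoint get different colors. -/
def ProperOn {V : Type*} (E₀ : Set (Sym2 V)) (C : Sym2 V → ℕ) : Prop :=
  ∀ e ∈ E₀, ∀ f ∈ E₀, e ≠ f → (∃ v, v ∈ e ∧ v ∈ f) → C e ≠ C f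

/-- `G` admits a proper edge-coloring using (at most) `t` colors. -/
def HasProperEdgeColoring {V : Type*} (G : SimpleGraph V) (t : ℕ) : Prop :=
  ∃ C : Sym2 V → ℕ, (∀ e ∈ G.edgeSet, C e < t) ∧ ProperOn G.edgeSet C

/-- The chromatic index `χ'(G)`. -/
noncomputable def chromIndex {V : Type*} (G : SimpleGraph V) : ℕ :=
  sInf {t | HasProperEdgeColoring G t}

/-- Every proper edge-precoloring of at most `k` edges of `G` extends to a
proper edge-coloring of `G` with `t` colors. -/
def PrecoloringExtendable {V : Type*} (G : SimpleGraph V) (k t : ℕ) : Prop :=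
  ∀ E₀ : Set (Sym2 V), E₀ ⊆ G.edgeSet → E₀.ncard ≤ k →
    ∀ c₀ : Sym2 V → ℕ, (∀ e ∈ E₀, c₀ e < t) → ProperOn E₀ c₀ →
      ∃ C : Sym2 V → ℕ, (∀ e ∈ G.edgeSet, C e < t) ∧ ProperOn G.edgeSet C ∧
        ∀ e ∈ E₀, C e = c₀ e

lemma Equiv.swap_apply_lt {a b n x : ℕ} (ha : a < n) (hb : b < n) (hx : x < n) :
    Equiv.swap a b x < n := by
  rw [Equiv.swap_apply_def]
  split_ifs <;> assumption

/-- Allowing one more precolored edge costs at most one more color: one color class of the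
precoloring is set aside, the rest is extended, and the class is put back with a fresh color. -/
lemma PrecoloringExtendable.succ {V : Type*} [Finite V] {G : SimpleGraph V} {k l : ℕ}
    (h : PrecoloringExtendable G k l) : PrecoloringExtendable G (k + 1) (l + 1) := by
  classical
  intro E₀ hE₀ hcard c₀ hc₀ hproper
  rcases E₀.eq_empty_or_nonempty with rfl | ⟨e, he⟩
  · obtain ⟨C, hC, hCp, hCe⟩ := h ∅ hE₀ (by simp) c₀ (by simp) (by simp [ProperOn])
    exact ⟨C, fun f hf => (hC f hf).trans l.lt_succ_self, hCp, by simp⟩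
  set σ : Equiv.Perm ℕ := Equiv.swap (c₀ e) l
  have hσlt : ∀ x < l + 1, σ x < l + 1 := fun x hx =>
    Equiv.swap_apply_lt (hc₀ e he) l.lt_succ_self hx
  have hσσ : ∀ x, σ (σ x) = x := Equiv.swap_apply_self _ _
  have hσe : σ (c₀ e) = l := Equiv.swap_apply_left _ _
  have hσl : ∀ f, c₀ f = c₀ e ↔ σ (c₀ f) = l := fun f => by
    rw [← hσe, σ.injective.eq_iff]
  let M : Set (Sym2 V) := {f ∈ E₀ | c₀ f = c₀ e}
  have hMcard : (E₀ \ M).ncard ≤ k := by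
    have : (E₀ \ M).ncard < E₀.ncard :=
      Set.ncard_lt_ncard ⟨Set.sdiff_subset, fun hs => (hs he).2 ⟨he, rfl⟩⟩ (Set.toFinite _)
    omega
  obtain ⟨C, hC, hCp, hCe⟩ := h (E₀ \ M) (Set.sdiff_subset.trans hE₀) hMcard (fun f => σ (c₀ f))
    (fun f hf => by
      have h₁ := hσlt _ (hc₀ f hf.1)
      have h₂ : σ (c₀ f) ≠ l := fun hl => hf.2 ⟨hf.1, (hσl f).2 hl⟩
      omega)
    (fun f hf g hg hne hv hfg => hproper f hf.1 g hg.1 hne hv (σ.injective hfg))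
  refine ⟨fun f => σ (if f ∈ M then l else C f), ?_, ?_, ?_⟩
  · intro f hf
    apply hσlt
    split_ifs
    · exact l.lt_succ_self
    · exact (hC f hf).trans l.lt_succ_self
  · intro f hf g hg hne hv hfg
    have hfg := σ.injective hfg
    have hCf := hC f hf
    have hCg := hC g hg
    split_ifs at hfg with h₁ h₂ h₂
    · exact hproper f h₁.1 g h₂.1 hne hv (h₁.2.trans h₂.2.symm)
    · omega
    · omega
    · exact hCp f hf g hg hne hv hfg
  · intro f hf
    dsimp only
    split_ifs with hM
    · rw [hM.2, ← hσe, hσσ]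
    · rw [hCe f ⟨hf, hM⟩, hσσ]

/-- **Lemma (extra colors).** If every precoloring of at most `k` edges of `G` extends to a
proper `l`-edge-coloring, then for every `m ≥ 0` every precoloring of at most `k+m` edges
extends to a proper `(l+m)`-edge-coloring. -/
theorem stmt_2 {V : Type*} [Fintype V] (G : SimpleGraph V) (k l : ℕ)
    (hext : PrecoloringExtendable G k l) :
    ∀ m : ℕ, PrecoloringExtendable G (k + m) (l + m) := by
  intro m
  induction m with
  | zero => exact hext
  | succ m ih => exact ih.succ
end

section
/- Let G be a subcubic simple graph (every vertex has degree at most 3). Then every proper edge-precoloring of at most three edges of G can be extended to a proper edge-coloring of G with 4 colors. -/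
open SimpleGraph

theorem exists_lt_four_ne (a b c : ℕ) : ∃ x < 4, x ≠ a ∧ x ≠ b ∧ x ≠ c := by
  by_contra! h
  have h0 := h 0
  have h1 := h 1
  have h2 := h 2
  have h3 := h 3
  omega

/-- List colouring of the edges of a cycle of length `n`, where the `i`-th edge must avoid the
colours `p i` and `p (i + 1)`, in the case where the last edge is not too constrained. -/
theorem exists_cyclic_coloring_of_last {n : ℕ} (hn : 2 ≤ n) (p : ℕ → ℕ) (hp4 : ∀ i, p i < 4)
    (hp : Function.Periodic p n) (h : p (n - 1) = p 0 ∨ p (n - 1) ≠ p 1) :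
    ∃ c : ℕ → ℕ, Function.Periodic c n ∧
      ∀ i, c i < 4 ∧ c i ≠ p i ∧ c i ≠ p (i + 1) ∧ c i ≠ c (i + 1) := by
  obtain ⟨m, rfl⟩ : ∃ m, n = m + 2 := ⟨n - 2, by omega⟩
  simp only [show m + 2 - 1 = m + 1 by omega] at h
  obtain ⟨a, ha4, ha0, ha1, ha⟩ :
      ∃ a < 4, a ≠ p 0 ∧ a ≠ p 1 ∧ (p (m + 1) = p 0 ∨ a = p (m + 1)) := by
    by_cases h0 : p (m + 1) = p 0
    · obtain ⟨a, ha4, ha⟩ := exists_lt_four_ne (p 0) (p 1) 0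
      exact ⟨a, ha4, ha.1, ha.2.1, Or.inl h0⟩
    · exact ⟨p (m + 1), hp4 _, h0, h.resolve_left h0, Or.inr rfl⟩
  choose g hg4 hga hgb hgc using exists_lt_four_ne
  let s : ℕ → ℕ := fun k => Nat.rec a (fun j x => g (p (j + 1)) (p (j + 2)) x) k
  have hs0 : s 0 = a := rfl
  have hs : ∀ j, s (j + 1) = g (p (j + 1)) (p (j + 2)) (s j) := fun _ => rfl
  have hs' : ∀ j, s j < 4 ∧ s j ≠ p j ∧ s j ≠ p (j + 1) := by
    rintro (_ | j)
    · exact ⟨ha4, ha0, ha1⟩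
    · rw [hs]
      exact ⟨hg4 _ _ _, hga _ _ _, hgb _ _ _⟩
  obtain ⟨b, hb4, hb, hb0, hba, hbs⟩ :
      ∃ b < 4, b ≠ p (m + 1) ∧ b ≠ p 0 ∧ b ≠ a ∧ b ≠ s m := by
    rcases ha with ha | ha
    · obtain ⟨b, hb4, hb⟩ := exists_lt_four_ne (p 0) a (s m)
      exact ⟨b, hb4, ha ▸ hb.1, hb⟩
    · obtain ⟨b, hb4, hb⟩ := exists_lt_four_ne (p 0) a (s m)
      exact ⟨b, hb4, ha ▸ hb.2.1, hb⟩
  refine ⟨fun i => if i % (m + 2) = m + 1 then b else s (i % (m + 2)),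
    fun i => by simp, fun i => ?_⟩
  have hr : i % (m + 2) < m + 2 := Nat.mod_lt _ (by omega)
  have hpi : p i = p (i % (m + 2)) := (hp.map_mod_nat i).symm
  have hpi' : p (i + 1) = p ((i + 1) % (m + 2)) := (hp.map_mod_nat _).symm
  rw [hpi, hpi']
  by_cases hi : i % (m + 2) = m + 1
  · have hi' : (i + 1) % (m + 2) = 0 := by
      rw [Nat.add_mod, hi]
      simp
    simp [hi, hi', hb4, hb, hb0, hba, hs0]
  · have hi' : (i + 1) % (m + 2) = i % (m + 2) + 1 := by
      rw [Nat.add_mod, Nat.mod_eq_of_lt (a := 1) (by omega), Nat.mod_eq_of_lt (by omega)]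
    simp only [hi, hi', if_false]
    refine ⟨(hs' _).1, (hs' _).2.1, (hs' _).2.2, ?_⟩
    split_ifs with hm
    · have : i % (m + 2) = m := by omega
      rw [this]
      exact hbs.symm
    · rw [hs]
      exact (hgc _ _ _).symm

/-- The edges of a cycle of length `n` can be properly coloured with four colours so that the
`i`-th edge avoids the colours `p i` and `p (i + 1)` given at its two ends. -/
theorem exists_cyclic_coloring {n : ℕ} (hn : 2 ≤ n) (p : ℕ → ℕ) (hp4 : ∀ i, p i < 4)
    (hp : Function.Periodic p n) :
    ∃ c : ℕ → ℕ, Function.Periodic c n ∧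
      ∀ i, c i < 4 ∧ c i ≠ p i ∧ c i ≠ p (i + 1) ∧ c i ≠ c (i + 1) := by
  by_cases h : ∃ k, p (k + (n - 1)) = p k ∨ p (k + (n - 1)) ≠ p (k + 1)
  · obtain ⟨k, hk⟩ := h
    obtain ⟨c, hc, hcp⟩ := exists_cyclic_coloring_of_last hn (fun i => p (i + k))
      (fun i => hp4 _) (fun i => by simp only [Nat.add_right_comm i n k, hp _])
      (by simpa [add_comm] using hk)
    have key : ∀ i, p (i + (n - 1) * k + k) = p i := by
      intro i
      have : i + (n - 1) * k + k = i + k * n := by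
        obtain ⟨m, rfl⟩ : ∃ m, n = m + 1 := ⟨n - 1, by omega⟩
        simp only [Nat.add_sub_cancel]
        ring
      rw [this]
      exact hp.nat_mul k i
    refine ⟨fun i => c (i + (n - 1) * k), fun i => ?_, fun i => ?_⟩
    · simp only [Nat.add_right_comm i n, hc _]
    · obtain ⟨h1, h2, h3, h4⟩ := hcp (i + (n - 1) * k)
      refine ⟨h1, by rwa [key] at h2, ?_, ?_⟩
      · rwa [Nat.add_right_comm i _ 1, key] at h3
      · rwa [Nat.add_right_comm i _ 1] at h4
  · push Not at h
    have h1 : ∀ k, p (k + 1) ≠ p k := fun k hk => (h k).1 ((h k).2.trans hk)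
    have h2 : Function.Periodic p 2 := by
      intro k
      rw [← (h (k + 1)).2, show k + 1 + (n - 1) = k + n by omega, hp]
    have hp2 : ∀ k, p k = p (k % 2) := fun k => (h2.map_mod_nat k).symm
    have hn2 : n % 2 = 0 := by
      by_contra hodd
      have hn1 : n % 2 = 1 := by omega
      have := hp 0
      rw [zero_add, hp2 n, hn1] at this
      exact h1 0 this
    obtain ⟨a, ha4, ha0, ha1, -⟩ := exists_lt_four_ne (p 0) (p 1) 0
    obtain ⟨b, hb4, hb0, hb1, hba⟩ := exists_lt_four_ne (p 0) (p 1) a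
    refine ⟨fun i => if i % 2 = 0 then a else b, fun i => ?_, fun i => ?_⟩
    · simp [Nat.add_mod, hn2]
    · rw [hp2 i, hp2 (i + 1)]
      rcases Nat.mod_two_eq_zero_or_one i with hi | hi
      · have hi' : (i + 1) % 2 = 1 := by omega
        simp [hi, hi', ha4, ha0, ha1, hba.symm]
      · have hi' : (i + 1) % 2 = 0 := by omega
        simp [hi, hi', hb4, hb0, hb1, hba]

section EdgeColoring

open Finset Classical

variable {V : Type*}

/-- `C` restricts to a proper colouring of the edges in `D` with the colours `0, 1, 2, 3`. -/
def IsColoringOn (D : Finset (Sym2 V)) (C : Sym2 V → ℕ) : Prop :=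
  (∀ e ∈ D, C e < 4) ∧ ProperOn (D : Set (Sym2 V)) C

theorem IsColoringOn.mono {D D' : Finset (Sym2 V)} {C : Sym2 V → ℕ} (h : IsColoringOn D' C)
    (hD : D ⊆ D') : IsColoringOn D C :=
  ⟨fun e he => h.1 e (hD he), fun e he f hf => h.2 e (hD he) f (hD hf)⟩

theorem IsColoringOn.update {D : Finset (Sym2 V)} {C : Sym2 V → ℕ} (hC : IsColoringOn D C)
    {e : Sym2 V} (he : e ∉ D) {a : ℕ} (ha : a < 4)
    (hne : ∀ f ∈ D, (∃ v, v ∈ e ∧ v ∈ f) → C f ≠ a) :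
    IsColoringOn (insert e D) (Function.update C e a) := by
  have hup : ∀ f ∈ D, Function.update C e a f = C f := fun f hf =>
    Function.update_of_ne (ne_of_mem_of_not_mem hf he) _ _
  refine ⟨fun f hf => ?_, fun f hf g hg hfg ⟨v, hvf, hvg⟩ => ?_⟩
  · rcases mem_insert.1 hf with rfl | hf
    · simpa using ha
    · rw [hup f hf]
      exact hC.1 f hf
  · rw [mem_coe, mem_insert] at hf hg
    obtain rfl | hf := hf <;> obtain rfl | hg := hg
    · exact absurd rfl hfg
    · rw [hup g hg, Function.update_self]
      exact (hne g hg ⟨v, hvf, hvg⟩).symm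
    · rw [hup f hf, Function.update_self]
      exact hne f hf ⟨v, hvg, hvf⟩
    · rw [hup f hf, hup g hg]
      exact hC.2 f hf g hg hfg ⟨v, hvf, hvg⟩

/-- An edge that sees fewer than four colours can be coloured. -/
theorem IsColoringOn.exists_insert {D : Finset (Sym2 V)} {C : Sym2 V → ℕ}
    (hC : IsColoringOn D C) {e : Sym2 V} (he : e ∉ D)
    (hcard : #({f ∈ D | ∃ v, v ∈ e ∧ v ∈ f}.image C) < 4) :
    ∃ a, IsColoringOn (insert e D) (Function.update C e a) := by
  obtain ⟨a, ha, ha'⟩ := exists_mem_notMem_of_card_lt_card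
    (s := {f ∈ D | ∃ v, v ∈ e ∧ v ∈ f}.image C) (t := range 4) (by simpa using hcard)
  refine ⟨a, hC.update he (mem_range.1 ha) fun f hf hv hfa => ha' ?_⟩
  exact mem_image.2 ⟨f, mem_filter.2 ⟨hf, hv⟩, hfa⟩

/-- In a subcubic edge set, an edge to which a colouring of the other edges cannot be extended
has both ends of degree three. -/
theorem card_filter_mem_eq_three {F : Finset (Sym2 V)} (hdeg : ∀ v, #{e ∈ F | v ∈ e} ≤ 3)
    {e : Sym2 V} (heF : e ∈ F) {C : Sym2 V → ℕ} (hC : IsColoringOn (F.erase e) C)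
    (hN : ¬ ∃ a, IsColoringOn F (Function.update C e a)) {v : V} (hv : v ∈ e) :
    #{f ∈ F | v ∈ f} = 3 := by
  obtain ⟨w, rfl⟩ := hv
  have h4 : 4 ≤ #({f ∈ F.erase s(v, w) | ∃ x, x ∈ s(v, w) ∧ x ∈ f}.image C) := by
    by_contra! h
    have := hC.exists_insert (notMem_erase _ _) h
    rw [insert_erase heF] at this
    exact hN this
  have hsub : {f ∈ F.erase s(v, w) | ∃ x, x ∈ s(v, w) ∧ x ∈ f} ⊆
      {f ∈ F | v ∈ f}.erase s(v, w) ∪ {f ∈ F | w ∈ f}.erase s(v, w) := by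
    intro f
    simp only [mem_filter, mem_erase, mem_union, Sym2.mem_iff]
    rintro ⟨⟨h1, h2⟩, x, rfl | rfl, h⟩ <;> tauto
  have h1 := h4.trans (card_image_le.trans ((card_le_card hsub).trans (card_union_le _ _)))
  rw [card_erase_of_mem (by simp [heF]), card_erase_of_mem (by simp [heF])] at h1
  have := hdeg v
  have := hdeg w
  omega

/-- A proper colouring of a subcubic edge set minus the edges of a cycle extends to the cycle. -/
theorem exists_coloring_of_cycle {F : Finset (Sym2 V)} (hdeg : ∀ v, #{e ∈ F | v ∈ e} ≤ 3)
    {n : ℕ} (hn : 3 ≤ n) {v : ℕ → V} (hv : ∀ i j, v i = v j ↔ i ≡ j [MOD n])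
    (hF : ∀ i, s(v i, v (i + 1)) ∈ F) {C : Sym2 V → ℕ}
    (hC : IsColoringOn {e ∈ F | ∀ i, e ≠ s(v i, v (i + 1))} C) :
    ∃ C', IsColoringOn F C' ∧ ∀ e, (∀ i, e ≠ s(v i, v (i + 1))) → C' e = C e := by
  have hvn : ∀ i, v (i + n) = v i := fun i => (hv _ _).2 (by simp [Nat.ModEq])
  have hmod : ∀ i k, 0 < k → k < n → ¬ i ≡ i + k [MOD n] := by
    intro i k h0 hk h
    have := (Nat.modEq_iff_dvd' (by omega)).1 h
    rw [Nat.add_sub_cancel_left] at this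
    exact absurd (Nat.le_of_dvd h0 this) (by omega)
  have hindex : ∀ i j, s(v i, v (i + 1)) = s(v j, v (j + 1)) → i ≡ j [MOD n] := by
    intro i j h
    rcases Sym2.eq_iff.1 h with ⟨h, -⟩ | ⟨h1, h2⟩
    · exact (hv _ _).1 h
    · have h1 := (hv _ _).1 h1
      have h2 := (hv _ _).1 h2
      exact absurd (h2.symm.trans (h1.add_right 1)) (hmod j 2 (by omega) (by omega))
  have hthird : ∀ x, ∃ a < 4, ∀ j, v j = x →
      ∀ f ∈ F, (∀ i, f ≠ s(v i, v (i + 1))) → x ∈ f → C f = a := by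
    intro x
    by_cases hx : ∃ j, v j = x ∧ ∃ f ∈ F, (∀ i, f ≠ s(v i, v (i + 1))) ∧ x ∈ f
    · obtain ⟨j, rfl, f, hf, hfi, hxf⟩ := hx
      refine ⟨C f, hC.1 f (mem_filter.2 ⟨hf, hfi⟩), fun _ _ f' hf' hfi' hxf' => ?_⟩
      by_contra hne
      have hff : f ≠ f' := fun h => hne (h ▸ rfl)
      have hvj : v (j + (n - 1) + 1) = v j := by
        rw [show j + (n - 1) + 1 = j + n by omega, hvn]
      have hedge : s(v (j + (n - 1)), v (j + (n - 1) + 1)) ≠ s(v j, v (j + 1)) := fun h =>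
        hmod j (n - 1) (by omega) (by omega) (hindex _ _ h).symm
      have hsub : {f, f', s(v j, v (j + 1)), s(v (j + (n - 1)), v (j + (n - 1) + 1))} ⊆
          {e ∈ F | v j ∈ e} := by
        intro e he
        simp only [mem_insert, mem_singleton] at he
        rcases he with rfl | rfl | rfl | rfl
        · exact mem_filter.2 ⟨hf, hxf⟩
        · exact mem_filter.2 ⟨hf', hxf'⟩
        · exact mem_filter.2 ⟨hF j, by simp⟩
        · exact mem_filter.2 ⟨hF _, by simp [hvj]⟩
      have h4 := (card_le_card hsub).trans (hdeg (v j))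
      rw [card_insert_of_notMem, card_insert_of_notMem, card_insert_of_notMem, card_singleton] at h4
      · omega
      · simpa using hedge.symm
      · simp [hfi']
      · simp [hfi, hff]
    · exact ⟨0, by omega, fun j hj f hf hfi hxf => absurd ⟨j, hj, f, hf, hfi, hxf⟩ hx⟩
  choose q hq4 hq using hthird
  obtain ⟨c, hcn, hc⟩ := exists_cyclic_coloring (n := n) (by omega) (fun i => q (v i))
    (fun i => hq4 _) (fun i => by simp only [hvn])
  have hcmod : ∀ i j, i ≡ j [MOD n] → c i = c j := by
    intro i j hij
    rw [← hcn.map_mod_nat i, ← hcn.map_mod_nat j, hij]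
  let C' : Sym2 V → ℕ := fun e =>
    if h : ∃ i, e = s(v i, v (i + 1)) then c h.choose else C e
  have hC'c : ∀ i, C' s(v i, v (i + 1)) = c i := by
    intro i
    have h : ∃ j, s(v i, v (i + 1)) = s(v j, v (j + 1)) := ⟨i, rfl⟩
    simp only [C', dif_pos h]
    exact hcmod _ _ (hindex _ _ h.choose_spec).symm
  have hC'C : ∀ e, (∀ i, e ≠ s(v i, v (i + 1))) → C' e = C e := by
    intro e he
    simp only [C', dif_neg (not_exists.2 he)]
  have hmixed : ∀ i f x, f ∈ F → (∀ i, f ≠ s(v i, v (i + 1))) → x ∈ s(v i, v (i + 1)) →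
      x ∈ f → C f ≠ c i := by
    intro i f x hf hfi hxe hxf
    rcases Sym2.mem_iff.1 hxe with rfl | rfl
    · rw [hq _ i rfl f hf hfi hxf]
      exact (hc i).2.1.symm
    · rw [hq _ (i + 1) rfl f hf hfi hxf]
      exact (hc i).2.2.1.symm
  refine ⟨C', ⟨fun e he => ?_, fun e he f hf hef ⟨x, hxe, hxf⟩ => ?_⟩, hC'C⟩
  · by_cases hi : ∃ i, e = s(v i, v (i + 1))
    · obtain ⟨i, rfl⟩ := hi
      rw [hC'c]
      exact (hc i).1
    · rw [hC'C e (not_exists.1 hi)]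
      exact hC.1 e (mem_filter.2 ⟨he, not_exists.1 hi⟩)
  · by_cases hi : ∃ i, e = s(v i, v (i + 1)) <;> by_cases hj : ∃ j, f = s(v j, v (j + 1))
    · obtain ⟨i, rfl⟩ := hi
      obtain ⟨j, rfl⟩ := hj
      have hij : ¬ i ≡ j [MOD n] := fun h => hef <| by
        rw [(hv _ _).2 h, (hv _ _).2 (h.add_right 1)]
      rw [hC'c, hC'c]
      rcases Sym2.mem_iff.1 hxe with rfl | rfl <;> rcases Sym2.mem_iff.1 hxf with h | h <;>
        rw [hv] at h
      · exact absurd h hij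
      · rw [hcmod _ _ h]
        exact (hc j).2.2.2.symm
      · rw [← hcmod _ _ h]
        exact (hc i).2.2.2
      · exact absurd (Nat.ModEq.add_right_cancel' 1 h) hij
    · obtain ⟨i, rfl⟩ := hi
      rw [hC'c, hC'C f (not_exists.1 hj)]
      exact (hmixed i f x hf (not_exists.1 hj) hxe hxf).symm
    · obtain ⟨j, rfl⟩ := hj
      rw [hC'c, hC'C e (not_exists.1 hi)]
      exact hmixed j e x he (not_exists.1 hi) hxf hxe
    · rw [hC'C e (not_exists.1 hi), hC'C f (not_exists.1 hj)]
      exact hC.2 e (mem_filter.2 ⟨he, not_exists.1 hi⟩) f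
        (mem_filter.2 ⟨hf, not_exists.1 hj⟩) hef ⟨x, hxe, hxf⟩

/-- A graph that is not acyclic contains a cycle, given here as a periodic sequence of vertices. -/
theorem exists_periodic_of_not_isAcyclic {H : SimpleGraph V} (hH : ¬ H.IsAcyclic) :
    ∃ n, 3 ≤ n ∧ ∃ v : ℕ → V, (∀ i j, v i = v j ↔ i ≡ j [MOD n]) ∧
      ∀ i, H.Adj (v i) (v (i + 1)) := by
  simp only [IsAcyclic, not_forall, not_not] at hH
  obtain ⟨x, p, hp⟩ := hH
  have hn := hp.three_le_length
  refine ⟨p.length, hn, fun i => p.getVert (i % p.length), fun i j => ⟨fun h => ?_, fun h => ?_⟩,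
    fun i => ?_⟩
  · have hi := Nat.mod_lt i (show 0 < p.length by omega)
    have hj := Nat.mod_lt j (show 0 < p.length by omega)
    exact hp.getVert_injOn' (show i % p.length ≤ p.length - 1 by omega)
      (show j % p.length ≤ p.length - 1 by omega) h
  · simp only [show i % p.length = j % p.length from h]
  · have hi := Nat.mod_lt i (show 0 < p.length by omega)
    have hadj := p.adj_getVert_succ hi
    by_cases h : i % p.length + 1 = p.length
    · have h0 : (i + 1) % p.length = 0 := by
        rw [Nat.add_mod, Nat.mod_eq_of_lt (a := 1) (by omega), h, Nat.mod_self]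
      simp only [h0, Walk.getVert_zero]
      rwa [h, Walk.getVert_length] at hadj
    · have h1 : (i + 1) % p.length = i % p.length + 1 := by
        rw [Nat.add_mod, Nat.mod_eq_of_lt (a := 1) (by omega), Nat.mod_eq_of_lt (by omega)]
      simpa only [h1] using hadj

/-- The edges of an acyclic graph are fewer than the vertices that they touch. -/
theorem card_lt_card_of_isAcyclic {H : SimpleGraph V} (hH : H.IsAcyclic)
    {U : Finset (Sym2 V)} (hU : ∀ e ∈ U, e ∈ H.edgeSet) {X : Finset V} (hX : X.Nonempty)
    (hUX : ∀ e ∈ U, ∀ v ∈ e, v ∈ X) : #U < #X := by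
  have : Nonempty X := hX.to_subtype
  obtain ⟨T, hHT, -, hT⟩ := (connected_top (V := X)).exists_isTree_le_of_le_of_isAcyclic
    le_top (hH.comap (⟨(↑), fun h => h⟩ : H.comap ((↑) : X → V) →g H) Subtype.val_injective)
  have hcard := hT.card_edgeFinset
  rw [Fintype.card_coe] at hcard
  suffices #U ≤ #T.edgeFinset by omega
  have hsub : U ⊆ T.edgeFinset.image (Sym2.map (↑)) := by
    intro e he
    induction e with
    | _ a b =>
      refine mem_image.2 ⟨s(⟨a, hUX _ he a (by simp)⟩, ⟨b, hUX _ he b (by simp)⟩), ?_, rfl⟩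
      rw [mem_edgeFinset, mem_edgeSet]
      exact hHT (hU _ he)
  exact (card_le_card hsub).trans card_image_le

theorem eq_of_forall_mem_of_not_isDiag {a b c d : V} {e : Sym2 V} (he : ¬ e.IsDiag)
    (hmem : ∀ v ∈ e, v = a ∨ v = b ∨ v = c ∨ v = d) :
    e = s(a, b) ∨ e = s(c, d) ∨ e = s(a, c) ∨ e = s(b, d) ∨ e = s(a, d) ∨ e = s(b, c) := by
  induction e with
  | _ x y =>
    rw [Sym2.mk_isDiag_iff] at he
    rcases hmem x (by simp) with rfl | rfl | rfl | rfl <;>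
      rcases hmem y (by simp) with rfl | rfl | rfl | rfl <;> simp_all [Sym2.eq_swap]

theorem not_exists_mem_and_mem {x y z w : V} (hxz : x ≠ z) (hxw : x ≠ w) (hyz : y ≠ z)
    (hyw : y ≠ w) : ¬ ∃ v, v ∈ s(x, y) ∧ v ∈ s(z, w) := by
  rintro ⟨v, hv, hv'⟩
  rcases Sym2.mem_iff.1 hv with rfl | rfl <;> rcases Sym2.mem_iff.1 hv' with h | h <;>
    contradiction

/-- On four vertices, a precolouring of an edge set extends as soon as some precoloured edge is
disjoint from some uncoloured edge: both get the same colour. -/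
theorem exists_coloring_of_four_vertices {F E₀ : Finset (Sym2 V)} (hdiag : ∀ e ∈ F, ¬ e.IsDiag)
    (hE₀ : E₀ ⊆ F) {C : Sym2 V → ℕ} (hC : IsColoringOn E₀ C) {a b c d : V}
    (hac : a ≠ c) (had : a ≠ d) (hbc : b ≠ c) (hbd : b ≠ d)
    (hab : s(a, b) ∈ F \ E₀) (hcd : s(c, d) ∈ E₀)
    (hF : ∀ e ∈ F, ∀ v ∈ e, v = a ∨ v = b ∨ v = c ∨ v = d) :
    ∃ C', IsColoringOn F C' ∧ ∀ e ∈ E₀, C' e = C e := by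
  obtain ⟨habF, habE⟩ := mem_sdiff.1 hab
  have hshape : ∀ e ∈ F, _ := fun e he => eq_of_forall_mem_of_not_isDiag (hdiag e he) (hF e he)
  suffices h : ∀ S ⊆ F, ∃ C', IsColoringOn (insert s(a, b) E₀ ∪ S) C' ∧
      (∀ e ∈ E₀, C' e = C e) ∧ C' s(a, b) = C s(c, d) by
    obtain ⟨C', hC', hCE, -⟩ := h F subset_rfl
    exact ⟨C', hC'.mono subset_union_right, hCE⟩
  intro S
  induction S using Finset.induction_on with
  | empty =>
    intro _
    refine ⟨Function.update C s(a, b) (C s(c, d)), ?_, fun e he => ?_, Function.update_self ..⟩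
    · rw [union_empty]
      refine hC.update habE (hC.1 _ hcd) fun f hf hadj => ?_
      have hfne : f ≠ s(a, b) := ne_of_mem_of_not_mem hf habE
      have hne : ∀ v, (v = c ∨ v = d) → v ∈ f → f ≠ s(c, d) → C f ≠ C s(c, d) :=
        fun v hv hvf hne => hC.2 f hf _ hcd hne ⟨v, hvf, by simpa using hv⟩
      rcases hshape f (hE₀ hf) with rfl | rfl | rfl | rfl | rfl | rfl
      · exact absurd rfl hfne
      · exact absurd hadj (not_exists_mem_and_mem hac had hbc hbd)
      · exact hne c (by simp) (by simp) (by simp [hac, had])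
      · exact hne d (by simp) (by simp) (by simp [hbc, hbd])
      · exact hne d (by simp) (by simp) (by simp [hac, had])
      · exact hne c (by simp) (by simp) (by simp [hbc, hbd])
    · exact Function.update_of_ne (ne_of_mem_of_not_mem he habE) _ _
  | insert g S hg ih =>
    intro hS
    obtain ⟨hgF, hSF⟩ := insert_subset_iff.1 hS
    obtain ⟨C', hC', hCE, hCab⟩ := ih hSF
    by_cases hgD : g ∈ insert s(a, b) E₀ ∪ S
    · rw [union_insert, insert_eq_of_mem hgD]
      exact ⟨C', hC', hCE, hCab⟩
    have hgE : g ∉ insert s(a, b) E₀ := fun h => hgD (mem_union_left _ h)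
    have hDF : insert s(a, b) E₀ ∪ S ⊆ F :=
      union_subset (insert_subset_iff.2 ⟨habF, hE₀⟩) hSF
    have hcard : #({f ∈ insert s(a, b) E₀ ∪ S | ∃ v, v ∈ g ∧ v ∈ f}.image C') < 4 := by
      obtain ⟨k, l, hkl⟩ : ∃ k l, ∀ f ∈ F, f ≠ g → (∃ v, v ∈ g ∧ v ∈ f) →
          f = s(a, b) ∨ f = s(c, d) ∨ f = k ∨ f = l := by
        have hgab : g ≠ s(a, b) := fun h => hgE (by simp [h])
        have hgcd : g ≠ s(c, d) := fun h => hgE (by simp [h, hcd])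
        have hne : a ≠ b := by simpa using hdiag _ habF
        have hne' : c ≠ d := by simpa using hdiag _ (hE₀ hcd)
        have h1 := not_exists_mem_and_mem hne had hbc.symm hne'
        have h2 := not_exists_mem_and_mem hne hac hbd.symm hne'.symm
        have h1' := not_exists_mem_and_mem hne.symm hbc had.symm hne'.symm
        have h2' := not_exists_mem_and_mem hne.symm hbd hac.symm hne'
        rcases hshape g hgF with rfl | rfl | rfl | rfl | rfl | rfl
        · exact absurd rfl hgab
        · exact absurd rfl hgcd
        · refine ⟨s(a, d), s(b, c), fun f hf hfg hv => ?_⟩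
          rcases hshape f hf with h | h | h | h | h | h
          exacts [Or.inl h, Or.inr (Or.inl h), absurd h hfg, absurd (h ▸ hv) h1,
            Or.inr (Or.inr (Or.inl h)), Or.inr (Or.inr (Or.inr h))]
        · refine ⟨s(a, d), s(b, c), fun f hf hfg hv => ?_⟩
          rcases hshape f hf with h | h | h | h | h | h
          exacts [Or.inl h, Or.inr (Or.inl h), absurd (h ▸ hv) h1', absurd h hfg,
            Or.inr (Or.inr (Or.inl h)), Or.inr (Or.inr (Or.inr h))]
        · refine ⟨s(a, c), s(b, d), fun f hf hfg hv => ?_⟩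
          rcases hshape f hf with h | h | h | h | h | h
          exacts [Or.inl h, Or.inr (Or.inl h), Or.inr (Or.inr (Or.inl h)), Or.inr (Or.inr (Or.inr h)),
            absurd h hfg, absurd (h ▸ hv) h2]
        · refine ⟨s(a, c), s(b, d), fun f hf hfg hv => ?_⟩
          rcases hshape f hf with h | h | h | h | h | h
          exacts [Or.inl h, Or.inr (Or.inl h), Or.inr (Or.inr (Or.inl h)), Or.inr (Or.inr (Or.inr h)),
            absurd (h ▸ hv) h2', absurd h hfg]
      have hsub : {f ∈ insert s(a, b) E₀ ∪ S | ∃ v, v ∈ g ∧ v ∈ f}.image C' ⊆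
          {C s(c, d), C' k, C' l} := by
        intro x hx
        obtain ⟨f, hf, rfl⟩ := mem_image.1 hx
        obtain ⟨hfD, hfg⟩ := mem_filter.1 hf
        rcases hkl f (hDF hfD) (ne_of_mem_of_not_mem hfD hgD) hfg with rfl | rfl | rfl | rfl <;>
          simp [hCab, hCE _ hcd]
      exact (card_le_card hsub).trans_lt (card_le_three.trans_lt (by omega))
    obtain ⟨x, hx⟩ := hC'.exists_insert hgD hcard
    refine ⟨Function.update C' g x, by rwa [union_insert], fun e he => ?_, ?_⟩
    · rw [Function.update_of_ne, hCE e he]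
      exact ne_of_mem_of_not_mem (mem_insert_of_mem he) hgE
    · rw [Function.update_of_ne, hCab]
      exact ne_of_mem_of_not_mem (mem_insert_self _ _) hgE

/-- If the edges of a set `F` of nonloops not in a subset `E₀` of size at most three form a
nonempty forest all of whose vertices have degree three in `F`, then `F` is a complete graph on
four vertices, and some edge of `F` outside `E₀` is disjoint from some edge of `E₀`. -/
theorem exists_four_vertices [Fintype V] {F E₀ : Finset (Sym2 V)}
    (hdiag : ∀ e ∈ F, ¬ e.IsDiag) (hE₀ : E₀ ⊆ F) (hcard : #E₀ ≤ 3) (hne : (F \ E₀).Nonempty)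
    (hacyc : (fromEdgeSet (↑(F \ E₀) : Set (Sym2 V))).IsAcyclic)
    (hdeg : ∀ e ∈ F \ E₀, ∀ v ∈ e, #{f ∈ F | v ∈ f} = 3) :
    ∃ a b c d : V, a ≠ c ∧ a ≠ d ∧ b ≠ c ∧ b ≠ d ∧ s(a, b) ∈ F \ E₀ ∧ s(c, d) ∈ E₀ ∧
      ∀ e ∈ F, ∀ v ∈ e, v = a ∨ v = b ∨ v = c ∨ v = d := by
  set U := F \ E₀ with hU
  let X : Finset V := {v | ∃ e ∈ U, v ∈ e}
  let M : Finset (Sym2 V) := {e ∈ E₀ | ∀ v ∈ e, v ∈ X}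
  have hUX : ∀ e ∈ U, ∀ v ∈ e, v ∈ X := fun e he v hv => by
    simp only [X, mem_filter, mem_univ, true_and]
    exact ⟨e, he, hv⟩
  have hXne : X.Nonempty := by
    obtain ⟨e, he⟩ := hne
    exact ⟨e.out.1, hUX e he _ (Sym2.out_fst_mem e)⟩
  have hforest : #U < #X := card_lt_card_of_isAcyclic hacyc
    (fun e he => by
      rw [edgeSet_fromEdgeSet]
      exact ⟨he, hdiag e (mem_sdiff.1 he).1⟩) hXne hUX
  have hdisj : Disjoint U E₀ := sdiff_disjoint
  have hFU : U ∪ E₀ = F := sdiff_union_of_subset hE₀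
  have hcount : 3 * #X = ∑ e ∈ U, #{v ∈ X | v ∈ e} + ∑ e ∈ E₀, #{v ∈ X | v ∈ e} := by
    have hswap := sum_card_bipartiteAbove_eq_sum_card_bipartiteBelow (s := X) (t := F)
      (fun (v : V) (e : Sym2 V) => v ∈ e)
    simp only [bipartiteAbove, bipartiteBelow] at hswap
    rw [← sum_union hdisj, hFU, ← hswap, mul_comm, ← smul_eq_mul, ← sum_const]
    refine sum_congr rfl fun v hv => ?_
    obtain ⟨e, he, hve⟩ := (mem_filter.1 hv).2
    exact (hdeg e he v hve).symm
  have htwo : ∀ e : Sym2 V, #{v ∈ X | v ∈ e} ≤ 2 := by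
    intro e
    induction e with
    | _ x y =>
      refine (card_le_card (t := {x, y}) fun v hv => ?_).trans card_le_two
      simpa using (mem_filter.1 hv).2
  have hone : ∀ e : Sym2 V, ¬ (∀ v ∈ e, v ∈ X) → #{v ∈ X | v ∈ e} ≤ 1 := by
    intro e he
    induction e with
    | _ x y =>
      simp only [Sym2.mem_iff, forall_eq_or_imp, forall_eq] at he
      rw [card_le_one]
      intro v hv w hw
      simp only [mem_filter, Sym2.mem_iff] at hv hw
      grind
  have hsumU : ∑ e ∈ U, #{v ∈ X | v ∈ e} ≤ 2 * #U := by
    rw [mul_comm, ← smul_eq_mul]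
    exact sum_le_card_nsmul _ _ _ fun e _ => htwo e
  have hsumE : ∑ e ∈ E₀, #{v ∈ X | v ∈ e} ≤ #E₀ + #M := by
    rw [card_eq_sum_ones, card_filter, ← sum_add_distrib]
    refine sum_le_sum fun e _ => ?_
    split_ifs with h
    · exact htwo e
    · exact hone e h
  have hpairs : U ∪ M ⊆ X.offDiag.image Sym2.mk.uncurry := by
    intro e he
    have hX : ∀ v ∈ e, v ∈ X := by
      rcases mem_union.1 he with he | he
      · exact hUX e he
      · exact (mem_filter.1 he).2
    have hd : ¬ e.IsDiag := by
      refine hdiag e ?_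
      rcases mem_union.1 he with he | he
      · exact (mem_sdiff.1 he).1
      · exact hE₀ (mem_filter.1 he).1
    induction e with
    | _ x y =>
      exact mem_image.2 ⟨(x, y), mem_offDiag.2 ⟨hX x (by simp), hX y (by simp), by simpa using hd⟩,
        rfl⟩
  have hchoose := card_le_card hpairs
  have hM : #M ≤ #E₀ := card_filter_le _ _
  have hUM : #(U ∪ M) = #U + #M :=
    card_union_of_disjoint (hdisj.mono_right (filter_subset _ _))
  have hoff := Sym2.two_mul_card_image_offDiag X
  rw [offDiag_card] at hoff
  have hUpos := hne.card_pos
  have hX4 : #X ≤ 4 := by omega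
  have harith : #X = 4 ∧ #U = 3 ∧ #M = 3 := by
    obtain h | h | h | h | h : #X = 0 ∨ #X = 1 ∨ #X = 2 ∨ #X = 3 ∨ #X = 4 := by omega
    all_goals
      rw [h] at hoff hforest hcount ⊢
      omega
  obtain ⟨hX4, hU3, hM3⟩ := harith
  rw [hX4] at hoff
  have hMeq : M = E₀ := eq_of_subset_of_card_le (filter_subset _ _) (by omega)
  have hFeq : F = X.offDiag.image Sym2.mk.uncurry := by
    rw [← hFU, ← hMeq]
    exact eq_of_subset_of_card_le hpairs (by omega)
  have hFX : ∀ e ∈ F, ∀ v ∈ e, v ∈ X := by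
    rw [← hFU, ← hMeq]
    intro e he
    rcases mem_union.1 he with he | he
    · exact hUX e he
    · exact (mem_filter.1 he).2
  have hmemF : ∀ x ∈ X, ∀ y ∈ X, x ≠ y → s(x, y) ∈ F := fun x hx y hy hxy => by
    rw [hFeq]
    exact mem_image.2 ⟨(x, y), mem_offDiag.2 ⟨hx, hy, hxy⟩, rfl⟩
  obtain ⟨a, Y, haY, hXa, hY⟩ := card_eq_succ.1 hX4
  obtain ⟨b, c, d, hbc, hbd, hcd, rfl⟩ := card_eq_three.1 hY
  simp only [mem_insert, mem_singleton, not_or] at haY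
  obtain ⟨hab, hac, had⟩ := haY
  have hXmem : ∀ v, v ∈ X ↔ v = a ∨ v = b ∨ v = c ∨ v = d := fun v => by
    rw [← hXa]
    simp
  have hVF : ∀ e ∈ F, ∀ v ∈ e, v = a ∨ v = b ∨ v = c ∨ v = d := fun e he v hv =>
    (hXmem v).1 (hFX e he v hv)
  have haX : a ∈ X := by simp [hXmem]
  have hbX : b ∈ X := by simp [hXmem]
  have hcX : c ∈ X := by simp [hXmem]
  have hdX : d ∈ X := by simp [hXmem]
  by_contra! hcon
  have hiff : ∀ x y z w, x ∈ X → y ∈ X → z ∈ X → w ∈ X → x ≠ y → z ≠ w → x ≠ z → x ≠ w → y ≠ z →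
      y ≠ w → X ⊆ {x, y, z, w} → (s(x, y) ∈ U ↔ s(z, w) ∈ U) := by
    have : ∀ x y z w, z ∈ X → w ∈ X → z ≠ w → x ≠ z → x ≠ w → y ≠ z → y ≠ w →
        X ⊆ {x, y, z, w} → s(x, y) ∈ U → s(z, w) ∈ U := by
      intro x y z w hz hw hzw hxz hxw hyz hyw hX hxy
      by_contra hzwU
      have hzwE : s(z, w) ∈ E₀ := by
        by_contra h
        exact hzwU (mem_sdiff.2 ⟨hmemF z hz w hw hzw, h⟩)
      obtain ⟨e, he, v, hv, h1, h2, h3, h4⟩ := hcon x y z w hxz hxw hyz hyw hxy hzwE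
      have hvX := hX (hFX e he v hv)
      simp only [mem_insert, mem_singleton] at hvX
      tauto
    intro x y z w hx hy hz hw hxy hzw hxz hxw hyz hyw hX
    refine ⟨this x y z w hz hw hzw hxz hxw hyz hyw hX,
      this z w x y hx hy hxy hxz.symm hyz.symm hxw.symm hyw.symm (hX.trans ?_)⟩
    intro v
    simp only [mem_insert, mem_singleton]
    tauto
  have hsub : ∀ x y z w, (∀ v, v ∈ X → v = x ∨ v = y ∨ v = z ∨ v = w) → X ⊆ {x, y, z, w} :=
    fun x y z w h v hv => by simpa using h v hv
  have h1 := hiff a b c d haX hbX hcX hdX hab hcd hac had hbc hbd (hsub _ _ _ _ (by grind))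
  have h2 := hiff a c b d haX hcX hbX hdX hac hbd hab had hbc.symm hcd (hsub _ _ _ _ (by grind))
  have h3 := hiff a d b c haX hdX hbX hcX had hbc hab hac hbd.symm hcd.symm
    (hsub _ _ _ _ (by grind))
  have hUeq : U = {e ∈ ({s(a, b), s(c, d), s(a, c), s(b, d), s(a, d), s(b, c)} :
      Finset (Sym2 V)) | e ∈ U} := by
    ext e
    rw [mem_filter]
    refine ⟨fun he => ⟨?_, he⟩, And.right⟩
    have heF := (mem_sdiff.1 he).1
    simpa using eq_of_forall_mem_of_not_isDiag (hdiag e heF) (hVF e heF)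
  rw [hUeq, card_filter, sum_insert, sum_insert, sum_insert, sum_insert, sum_insert,
    sum_singleton] at hU3
  · simp only [h1, h2, h3] at hU3
    omega
  all_goals
    simp [hab, hac, had, hbc, hbd, hcd, Ne.symm hab, Ne.symm hac, Ne.symm had, hbc.symm, hbd.symm,
      hcd.symm]

/-- In a subcubic set of nonloop edges, a proper precolouring of at most three edges extends to a
proper colouring with four colours. -/
theorem exists_coloring_of_card_le_three [Fintype V] (F : Finset (Sym2 V)) :
    ∀ {E₀ : Finset (Sym2 V)} {C₀ : Sym2 V → ℕ}, (∀ e ∈ F, ¬ e.IsDiag) →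
      (∀ v, #{e ∈ F | v ∈ e} ≤ 3) → E₀ ⊆ F → #E₀ ≤ 3 → IsColoringOn E₀ C₀ →
      ∃ C, IsColoringOn F C ∧ ∀ e ∈ E₀, C e = C₀ e := by
  induction F using Finset.strongInduction with
  | H F ih =>
  intro E₀ C₀ hdiag hdeg hE₀ hcard hC₀
  have ih' : ∀ D ⊂ F, E₀ ⊆ D → ∃ C, IsColoringOn D C ∧ ∀ e ∈ E₀, C e = C₀ e :=
    fun D hD hED => ih D hD (fun e he => hdiag e (hD.1 he))
      (fun v => (card_le_card (filter_subset_filter _ hD.1)).trans (hdeg v)) hED hcard hC₀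
  by_contra hN
  have hne : (F \ E₀).Nonempty := by
    by_contra h
    rw [not_nonempty_iff_eq_empty, sdiff_eq_empty_iff_subset] at h
    exact hN ⟨C₀, hC₀.mono h, fun _ _ => rfl⟩
  by_cases hacyc : (fromEdgeSet (↑(F \ E₀) : Set (Sym2 V))).IsAcyclic
  · have hdeg3 : ∀ e ∈ F \ E₀, ∀ v ∈ e, #{f ∈ F | v ∈ f} = 3 := by
      intro e he v hv
      obtain ⟨heF, heE⟩ := mem_sdiff.1 he
      obtain ⟨C, hC, hCE⟩ := ih' _ (erase_ssubset heF) (subset_erase.2 ⟨hE₀, heE⟩)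
      refine card_filter_mem_eq_three hdeg heF hC (fun ⟨a, ha⟩ => hN ⟨_, ha, fun f hf => ?_⟩) hv
      rw [Function.update_of_ne (ne_of_mem_of_not_mem hf heE), hCE f hf]
    obtain ⟨a, b, c, d, hac, had, hbc, hbd, hab, hcd, hF⟩ :=
      exists_four_vertices hdiag hE₀ hcard hne hacyc hdeg3
    exact hN (exists_coloring_of_four_vertices hdiag hE₀ hC₀ hac had hbc hbd hab hcd hF)
  · obtain ⟨n, hn, v, hv, hadj⟩ := exists_periodic_of_not_isAcyclic hacyc
    have hU : ∀ i, s(v i, v (i + 1)) ∈ F \ E₀ := fun i => ((fromEdgeSet_adj _).1 (hadj i)).1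
    have hoff : ∀ e ∈ E₀, ∀ i, e ≠ s(v i, v (i + 1)) := fun e he i =>
      ne_of_mem_of_not_mem he (mem_sdiff.1 (hU i)).2
    obtain ⟨C, hC, hCE⟩ := ih' {e ∈ F | ∀ i, e ≠ s(v i, v (i + 1))}
      (filter_ssubset.2 ⟨s(v 0, v (0 + 1)), (mem_sdiff.1 (hU 0)).1, fun h => h 0 rfl⟩)
      (fun e he => mem_filter.2 ⟨hE₀ he, hoff e he⟩)
    obtain ⟨C', hC', hC'C⟩ :=
      exists_coloring_of_cycle hdeg hn hv (fun i => (mem_sdiff.1 (hU i)).1) hC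
    exact hN ⟨C', hC', fun e he => by rw [hC'C e (hoff e he), hCE e he]⟩

end EdgeColoring

/-- **Theorem (subcubic, 3 edges).** If `G` is subcubic, then every proper precoloring of at
most three edges of `G` extends to a proper 4-edge-coloring of `G`. -/
theorem stmt_6 {V : Type*} [Fintype V] (G : SimpleGraph V) [DecidableRel G.Adj]
    (hsub : ∀ v : V, G.degree v ≤ 3) :
    PrecoloringExtendable G 3 4 := by
  classical
  intro E₀ hE₀ hcard c₀ hc₀ hproper
  have hfin : E₀.Finite := Set.toFinite E₀
  obtain ⟨C, hC, hCE⟩ := exists_coloring_of_card_le_three G.edgeFinset (E₀ := hfin.toFinset)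
    (C₀ := c₀) (fun e he => G.not_isDiag_of_mem_edgeSet (mem_edgeFinset.1 he))
    (fun v => by
      refine le_of_eq_of_le ?_ (hsub v)
      rw [← card_incidenceFinset_eq_degree, incidenceFinset_eq_filter])
    (fun e he => mem_edgeFinset.2 (hE₀ (hfin.mem_toFinset.1 he)))
    (by rwa [← Set.ncard_eq_toFinset_card E₀ hfin])
    ⟨fun e he => hc₀ e (hfin.mem_toFinset.1 he), by rwa [hfin.coe_toFinset]⟩
  refine ⟨C, fun e he => hC.1 e (mem_edgeFinset.2 he), ?_,
    fun e he => hCE e (hfin.mem_toFinset.2 he)⟩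
  have := hC.2
  rwa [coe_edgeFinset] at this
end

section
/- Let G be a subcubic simple graph whose vertex set can be partitioned into two sets U and V such that the subgraph of G induced by V contains at most one edge and every vertex of U has degree at most two in G. Then G has a proper edge-coloring with 3 colors (i.e., χ'(G) ≤ 3). -/
open SimpleGraph

/-- `C` is a proper coloring of the edges of `G` with colors `0, 1, 2`. -/
structure IsThreeEdgeColoring {V : Type*} (G : SimpleGraph V) (C : Sym2 V → ℕ) : Prop where
  lt : ∀ v w, G.Adj v w → C s(v, w) < 3
  inj : ∀ v w w', G.Adj v w → G.Adj v w' → C s(v, w) = C s(v, w') → w = w'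

theorem IsThreeEdgeColoring.hasProperEdgeColoring {V : Type*} {G : SimpleGraph V}
    {C : Sym2 V → ℕ} (h : IsThreeEdgeColoring G C) : HasProperEdgeColoring G 3 := by
  refine ⟨C, ?_, ?_⟩
  · rintro ⟨v, w⟩ he
    exact h.lt v w he
  · rintro e he f hf hne ⟨v, hve, hvf⟩ heq
    obtain ⟨a, rfl⟩ := hve
    obtain ⟨b, rfl⟩ := hvf
    exact hne (by rw [h.inj v a b he hf heq])

/-- In a graph of maximum degree at most two, a connected component contains at most two
vertices of degree at most one. -/
theorem SimpleGraph.not_reachable_of_degree_le_two {V : Type*} [Finite V] {K : SimpleGraph V}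
    (hK : ∀ v, (K.neighborSet v).ncard ≤ 2) {v u x : V} (hvu : v ≠ u) (hvx : v ≠ x) (hux : u ≠ x)
    (hv : (K.neighborSet v).ncard ≤ 1) (hu : (K.neighborSet u).ncard ≤ 1)
    (hx : (K.neighborSet x).ncard ≤ 1) (hru : K.Reachable v u) : ¬ K.Reachable v x := by
  classical
  intro hrx
  have := Fintype.ofFinite V
  let c := K.connectedComponentMk v
  have hconn : (K.induce c.supp).Connected := c.connected_toSimpleGraph
  have hle : ∀ w : c.supp, (K.induce c.supp).degree w ≤ (K.neighborSet (w : V)).ncard := by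
    intro w
    rw [← card_neighborFinset_eq_degree, ← Set.ncard_coe_finset]
    refine Set.ncard_le_ncard_of_injOn Subtype.val ?_ Subtype.val_injective.injOn
    intro z hz
    simpa using hz
  let v' : c.supp := ⟨v, rfl⟩
  let u' : c.supp := ⟨u, ConnectedComponent.sound hru.symm⟩
  let x' : c.supp := ⟨x, ConnectedComponent.sound hrx.symm⟩
  have hsum : ∑ w : c.supp, ((K.induce c.supp).degree w +
      if w ∈ ({v', u', x'} : Finset c.supp) then 1 else 0) ≤ ∑ _w : c.supp, 2 := by
    refine Finset.sum_le_sum fun w _ => ?_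
    have h2 := (hle w).trans (hK w)
    split_ifs with hw
    · simp only [Finset.mem_insert, Finset.mem_singleton] at hw
      have := hle w
      rcases hw with rfl | rfl | rfl
      · exact Nat.succ_le_succ (this.trans hv)
      · exact Nat.succ_le_succ (this.trans hu)
      · exact Nat.succ_le_succ (this.trans hx)
    · exact h2
  have hthree : ({v', u', x'} : Finset c.supp).card = 3 :=
    Finset.card_eq_three.2 ⟨v', u', x', fun h => hvu (congrArg Subtype.val h),
      fun h => hvx (congrArg Subtype.val h), fun h => hux (congrArg Subtype.val h), rfl⟩
  rw [Finset.sum_add_distrib, sum_degrees_eq_twice_card_edges, Finset.sum_ite_mem,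
    Finset.univ_inter, Finset.sum_const, Finset.sum_const, hthree, Finset.card_univ] at hsum
  have hedge := hconn.card_vert_le_card_edgeSet_add_one
  rw [Nat.card_eq_fintype_card, Nat.card_eq_fintype_card, ← edgeFinset_card] at hedge
  simp only [smul_eq_mul] at hsum
  omega

/-- The subgraph of the edges colored `p` or `q`, whose components are the Kempe chains. -/
def kempeGraph {V : Type*} (G : SimpleGraph V) (C : Sym2 V → ℕ) (p q : ℕ) : SimpleGraph V where
  Adj a b := G.Adj a b ∧ (C s(a, b) = p ∨ C s(a, b) = q)
  symm := ⟨fun a b h => by rw [Sym2.eq_swap]; exact ⟨h.1.symm, h.2⟩⟩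
  loopless := ⟨fun a h => h.1.ne rfl⟩

/-- Swapping two colors on a union of Kempe chains yields a proper coloring. -/
theorem IsThreeEdgeColoring.exists_kempe_swap {V : Type*} {G : SimpleGraph V} {C : Sym2 V → ℕ}
    (h : IsThreeEdgeColoring G C) {p q : ℕ} (hp : p < 3) (hq : q < 3) (S : Set V)
    (hS : ∀ a b, (kempeGraph G C p q).Adj a b → a ∈ S → b ∈ S) :
    ∃ C' : Sym2 V → ℕ, IsThreeEdgeColoring G C' ∧
      (∀ a b, G.Adj a b → a ∈ S → C' s(a, b) = Equiv.swap p q (C s(a, b))) ∧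
      (∀ a b, G.Adj a b → a ∉ S → C' s(a, b) = C s(a, b)) := by
  classical
  let C' : Sym2 V → ℕ := fun e => if ∃ a ∈ e, a ∈ S then Equiv.swap p q (C e) else C e
  have hin : ∀ a b, G.Adj a b → a ∈ S → C' s(a, b) = Equiv.swap p q (C s(a, b)) :=
    fun a b _ ha => if_pos ⟨a, Sym2.mem_mk_left a b, ha⟩
  have hout : ∀ a b, G.Adj a b → a ∉ S → C' s(a, b) = C s(a, b) := by
    intro a b hab ha
    by_cases hb : b ∈ S
    · have hnot : ¬ (C s(a, b) = p ∨ C s(a, b) = q) := fun hc =>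
        ha (hS b a (SimpleGraph.Adj.symm (G := kempeGraph G C p q) ⟨hab, hc⟩) hb)
      push Not at hnot
      rw [show C' s(a, b) = Equiv.swap p q (C s(a, b)) from
        if_pos ⟨b, Sym2.mem_mk_right a b, hb⟩, Equiv.swap_apply_of_ne_of_ne hnot.1 hnot.2]
    · refine if_neg ?_
      rintro ⟨z, hz, hzS⟩
      rcases Sym2.mem_iff.1 hz with rfl | rfl
      exacts [ha hzS, hb hzS]
  refine ⟨C', ⟨fun a b hab => ?_, fun a b b' hab hab' heq => ?_⟩, hin, hout⟩
  · have hlt := h.lt a b hab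
    by_cases ha : a ∈ S
    · rw [hin a b hab ha, Equiv.swap_apply_def]
      split_ifs <;> assumption
    · rwa [hout a b hab ha]
  · refine h.inj a b b' hab hab' ?_
    by_cases ha : a ∈ S
    · rw [hin a b hab ha, hin a b' hab' ha] at heq
      exact (Equiv.swap p q).injective heq
    · rwa [hout a b hab ha, hout a b' hab' ha] at heq

/-- An edge can be colored with a color missing at both of its endpoints. -/
theorem IsThreeEdgeColoring.insert_edge {V : Type*} [DecidableEq V] {G H : SimpleGraph V}
    {C : Sym2 V → ℕ} (h : IsThreeEdgeColoring H C) {v u : V} {p : ℕ} (hp : p < 3)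
    (hG : ∀ a b, G.Adj a b → s(a, b) ≠ s(v, u) → H.Adj a b)
    (hv : ∀ w, H.Adj v w → C s(v, w) ≠ p) (hu : ∀ w, H.Adj u w → C s(u, w) ≠ p) :
    IsThreeEdgeColoring G (Function.update C s(v, u) p) := by
  have hmiss : ∀ a b b', s(a, b) = s(v, u) → H.Adj a b' → C s(a, b') ≠ p := by
    intro a b b' he hab
    rcases Sym2.mem_iff.1 (he ▸ Sym2.mem_mk_left a b) with rfl | rfl
    exacts [hv b' hab, hu b' hab]
  constructor
  · intro a b hab
    by_cases he : s(a, b) = s(v, u)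
    · rw [he, Function.update_self]
      exact hp
    · rw [Function.update_of_ne he]
      exact h.lt a b (hG a b hab he)
  · intro a b b' hab hab' heq
    by_cases he : s(a, b) = s(v, u) <;> by_cases he' : s(a, b') = s(v, u)
    · exact Sym2.congr_right.1 (he.trans he'.symm)
    · rw [he, Function.update_self, Function.update_of_ne he'] at heq
      exact absurd heq.symm (hmiss a b b' he (hG a b' hab' he'))
    · rw [he', Function.update_self, Function.update_of_ne he] at heq
      exact absurd heq (hmiss a b' b he' (hG a b hab he))
    · rw [Function.update_of_ne he, Function.update_of_ne he'] at heq
      exact h.inj a b b' (hG a b hab he) (hG a b' hab' he') heq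

/-- All edges at a vertex of degree at most one share a color. -/
theorem IsThreeEdgeColoring.exists_color {V : Type*} {G : SimpleGraph V} {C : Sym2 V → ℕ}
    (h : IsThreeEdgeColoring G C) {v : V} (hv : (G.neighborSet v).Subsingleton) :
    ∃ a < 3, ∀ w, G.Adj v w → C s(v, w) = a := by
  by_cases hw : ∃ w, G.Adj v w
  · obtain ⟨w, hw⟩ := hw
    exact ⟨_, h.lt v w hw, fun w' hw' => by rw [hv hw hw']⟩
  · push Not at hw
    exact ⟨0, by norm_num, fun w hvw => absurd hvw (hw w)⟩

/-- Two edges at `v` can be colored if the edges at each of `v`, `u` and `x` are monochromatic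
and the three colors leave distinct choices. -/
theorem IsThreeEdgeColoring.insert_two_edges {V : Type*} {G H : SimpleGraph V}
    {C : Sym2 V → ℕ} (h : IsThreeEdgeColoring H C) {v u x : V} (hvx : v ≠ x) (hux : u ≠ x)
    (hG : ∀ a b, G.Adj a b → s(a, b) ≠ s(v, u) → s(a, b) ≠ s(v, x) → H.Adj a b)
    {a b c : ℕ} (ha : a < 3) (hb : b < 3) (hc : c < 3) (hv : ∀ w, H.Adj v w → C s(v, w) = a)
    (hu : ∀ w, H.Adj u w → C s(u, w) = b) (hx : ∀ w, H.Adj x w → C s(x, w) = c)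
    (habc : b = c → b = a) : ∃ C', IsThreeEdgeColoring G C' := by
  classical
  obtain ⟨p, q, hp, hq, hpq, hpa, hpb, hqa, hqc⟩ : ∃ p q : ℕ, p < 3 ∧ q < 3 ∧ p ≠ q ∧
      a ≠ p ∧ b ≠ p ∧ a ≠ q ∧ c ≠ q := by
    have key : ∀ a b c : Fin 3, (b = c → b = a) →
        ∃ p q : Fin 3, p ≠ q ∧ a ≠ p ∧ b ≠ p ∧ a ≠ q ∧ c ≠ q := by decide
    obtain ⟨p, q, h⟩ := key ⟨a, ha⟩ ⟨b, hb⟩ ⟨c, hc⟩ (by simpa using habc)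
    exact ⟨p, q, p.2, q.2, by simpa [Fin.ext_iff] using h⟩
  have hdel : ∀ a b, (G.deleteEdges {s(v, x)}).Adj a b ↔ G.Adj a b ∧ s(a, b) ≠ s(v, x) :=
    fun a b => deleteEdges_adj
  have hnot : ∀ {w}, s(x, w) ≠ s(v, u) := by
    intro w he
    rcases Sym2.mem_iff.1 (he ▸ Sym2.mem_mk_left x w) with h | h
    exacts [hvx h.symm, hux h.symm]
  have h' : IsThreeEdgeColoring (G.deleteEdges {s(v, x)}) (Function.update C s(v, u) p) :=
    h.insert_edge hp (fun a b hab hne => hG a b ((hdel a b).1 hab).1 hne ((hdel a b).1 hab).2)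
      (fun w hw => (hv w hw).trans_ne hpa) (fun w hw => (hu w hw).trans_ne hpb)
  refine ⟨_, h'.insert_edge hq (fun a b hab hne => (hdel a b).2 ⟨hab, hne⟩) ?_ ?_⟩
  · intro w hw
    obtain ⟨hw, hwx⟩ := (hdel v w).1 hw
    by_cases hwu : s(v, w) = s(v, u)
    · rwa [hwu, Function.update_self]
    · rw [Function.update_of_ne hwu]
      exact (hv w (hG v w hw hwu hwx)).trans_ne hqa
  · intro w hw
    obtain ⟨hw, hwx⟩ := (hdel x w).1 hw
    rw [Function.update_of_ne hnot]
    exact (hx w (hG x w hw hnot hwx)).trans_ne hqc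

/-- Two edges `vu` and `vx` can be added to a properly colored graph in which `v`, `u` and `x`
have degree at most one. -/
theorem IsThreeEdgeColoring.exists_insert_two_edges {V : Type*} [Finite V] {G H : SimpleGraph V}
    {C : Sym2 V → ℕ} (h : IsThreeEdgeColoring H C) {v u x : V} (hvu : v ≠ u) (hvx : v ≠ x)
    (hux : u ≠ x) (hG : ∀ a b, G.Adj a b → s(a, b) ≠ s(v, u) → s(a, b) ≠ s(v, x) → H.Adj a b)
    (hv : (H.neighborSet v).Subsingleton) (hu : (H.neighborSet u).Subsingleton)
    (hx : (H.neighborSet x).Subsingleton) : ∃ C', IsThreeEdgeColoring G C' := by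
  obtain ⟨a, ha, hva⟩ := h.exists_color hv
  obtain ⟨b, hb, hub⟩ := h.exists_color hu
  obtain ⟨c, hc, hxc⟩ := h.exists_color hx
  by_cases habc : b = c → b = a
  · exact h.insert_two_edges hvx hux hG ha hb hc hva hub hxc habc
  push Not at habc
  obtain ⟨rfl, hba⟩ := habc
  let K := kempeGraph H C a b
  have hsub : ∀ {w}, (H.neighborSet w).Subsingleton → (K.neighborSet w).ncard ≤ 1 := by
    intro w hw
    exact (Set.ncard_le_one_iff (Set.toFinite _)).2 fun hy hz => hw hy.1 hz.1
  have hK : ∀ w, (K.neighborSet w).ncard ≤ 2 := by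
    intro w
    refine (Set.ncard_le_ncard_of_injOn (t := {a, b}) (fun y => C s(w, y)) (fun y hy => hy.2)
      fun y hy z hz => h.inj w y z hy.1 hz.1).trans 
      ((Set.ncard_insert_le a {b}).trans_eq (by rw [Set.ncard_singleton]))
  obtain ⟨C', h', hin, hout⟩ := h.exists_kempe_swap ha hb {w | K.Reachable v w}
    fun y z hyz hy => hy.trans hyz.reachable
  have hv' : ∀ w, H.Adj v w → C' s(v, w) = b := fun w hw => by
    rw [hin v w hw (Reachable.refl v), hva w hw, Equiv.swap_apply_left]
  have hin' : ∀ {y}, K.Reachable v y → (∀ w, H.Adj y w → C s(y, w) = b) →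
      ∀ w, H.Adj y w → C' s(y, w) = a := fun {y} hy hyb w hw => by
    rw [hin y w hw hy, hyb w hw, Equiv.swap_apply_right]
  have hout' : ∀ {y}, ¬ K.Reachable v y → (∀ w, H.Adj y w → C s(y, w) = b) →
      ∀ w, H.Adj y w → C' s(y, w) = b := fun {y} hy hyb w hw => by
    rw [hout y w hw hy, hyb w hw]
  by_cases hru : K.Reachable v u
  · have hrx := not_reachable_of_degree_le_two hK hvu hvx hux (hsub hv) (hsub hu) (hsub hx) hru
    exact h'.insert_two_edges hvx hux hG hb ha hb hv' (hin' hru hub) (hout' hrx hxc)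
      fun hab => absurd hab.symm hba
  · by_cases hrx : K.Reachable v x
    · exact h'.insert_two_edges hvx hux hG hb hb ha hv' (hout' hru hub) (hin' hrx hxc)
        fun _ => rfl
    · exact h'.insert_two_edges hvx hux hG hb hb hb hv' (hout' hru hub) (hout' hrx hxc)
        fun _ => rfl

/-- A finite subcubic graph in which every vertex of degree three has at most one neighbor of
degree three is 3-edge-colorable. -/
theorem SimpleGraph.exists_isThreeEdgeColoring {V : Type*} [Finite V] (G : SimpleGraph V)
    (hsub : ∀ v, (G.neighborSet v).ncard ≤ 3)
    (hcore : ∀ v y z, G.Adj v y → G.Adj v z → 3 ≤ (G.neighborSet v).ncard →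
      3 ≤ (G.neighborSet y).ncard → 3 ≤ (G.neighborSet z).ncard → y = z) :
    ∃ C, IsThreeEdgeColoring G C := by
  classical
  induction G using WellFoundedLT.induction with
  | ind G ih =>
  have hcolor : ∀ H < G, ∃ C, IsThreeEdgeColoring H C := by
    intro H hH
    have hmono : ∀ w, (H.neighborSet w).ncard ≤ (G.neighborSet w).ncard :=
      fun w => Set.ncard_le_ncard fun y hy => hH.le hy
    exact ih H hH (fun w => (hmono w).trans (hsub w)) fun w y z hy hz h₁ h₂ h₃ =>
      hcore w y z (hH.le hy) (hH.le hz) (h₁.trans (hmono w)) (h₂.trans (hmono y))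
        (h₃.trans (hmono z))
  have hlt : ∀ {v u : V} {s : Set (Sym2 V)}, G.Adj v u → s(v, u) ∈ s → G.deleteEdges s < G := by
    intro v u s hvu hs
    refine lt_of_le_of_ne (deleteEdges_le s) fun he => ?_
    exact (deleteEdges_adj.1 (he.symm ▸ hvu)).2 hs
  have hdeg : ∀ {w y : V} {s : Set (Sym2 V)}, (G.neighborSet w).ncard ≤ 2 → G.Adj w y →
      s(w, y) ∈ s → ((G.deleteEdges s).neighborSet w).Subsingleton := by
    intro w y s hw hwy hs
    have hle : (G.neighborSet w \ {y}).ncard ≤ 1 := by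
      rw [Set.ncard_sdiff_singleton_of_mem (show y ∈ G.neighborSet w from hwy)]
      omega
    intro z hz z' hz'
    exact (Set.ncard_le_one_iff (Set.toFinite _)).1 hle
      ⟨(deleteEdges_adj.1 hz).1, fun h => (deleteEdges_adj.1 hz).2 (h ▸ hs)⟩
      ⟨(deleteEdges_adj.1 hz').1, fun h => (deleteEdges_adj.1 hz').2 (h ▸ hs)⟩
  by_cases hthree : ∃ v, 3 ≤ (G.neighborSet v).ncard
  · obtain ⟨v, hv⟩ := hthree
    obtain ⟨u, x, hvu, hvx, hux, hu, hx⟩ : ∃ u x, G.Adj v u ∧ G.Adj v x ∧ u ≠ x ∧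
        (G.neighborSet u).ncard ≤ 2 ∧ (G.neighborSet x).ncard ≤ 2 := by
      have hbig : ({y ∈ G.neighborSet v | 3 ≤ (G.neighborSet y).ncard}).ncard ≤ 1 :=
        (Set.ncard_le_one_iff (Set.toFinite _)).2 fun hy hz => hcore v _ _ hy.1 hz.1 hv hy.2 hz.2
      have hsmall : 1 < (G.neighborSet v \
          {y ∈ G.neighborSet v | 3 ≤ (G.neighborSet y).ncard}).ncard := by
        rw [Set.ncard_sdiff (Set.sep_subset _ _)]
        omega
      obtain ⟨u, x, ⟨hvu, hu⟩, ⟨hvx, hx⟩, hux⟩ := (Set.one_lt_ncard_iff (Set.toFinite _)).1 hsmall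
      exact ⟨u, x, hvu, hvx, hux, by_contra fun h => hu ⟨hvu, by omega⟩,
        by_contra fun h => hx ⟨hvx, by omega⟩⟩
    let s : Set (Sym2 V) := {s(v, u), s(v, x)}
    have hus : s(v, u) ∈ s := Or.inl rfl
    have hxs : s(v, x) ∈ s := Or.inr rfl
    obtain ⟨C, hC⟩ := hcolor (G.deleteEdges s) (hlt hvu hus)
    refine hC.exists_insert_two_edges hvu.ne hvx.ne hux ?_ ?_
      (hdeg hu hvu.symm (by rwa [Sym2.eq_swap])) (hdeg hx hvx.symm (by rwa [Sym2.eq_swap]))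
    · exact fun a b hab h₁ h₂ => deleteEdges_adj.2 ⟨hab, fun h => h.elim h₁ h₂⟩
    · have hle : ((G.neighborSet v \ {u}) \ {x}).ncard ≤ 1 := by
        rw [Set.ncard_sdiff_singleton_of_mem (show x ∈ G.neighborSet v \ {u} from ⟨hvx, hux.symm⟩),
          Set.ncard_sdiff_singleton_of_mem (show u ∈ G.neighborSet v from hvu)]
        have := hsub v
        omega
      have hmem : ∀ z ∈ (G.deleteEdges s).neighborSet v, z ∈ (G.neighborSet v \ {u}) \ {x} :=
        fun z hz => ⟨⟨(deleteEdges_adj.1 hz).1, fun h => (deleteEdges_adj.1 hz).2 (h ▸ hus)⟩,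
          fun h => (deleteEdges_adj.1 hz).2 (h ▸ hxs)⟩
      exact fun y hy z hz => (Set.ncard_le_one_iff (Set.toFinite _)).1 hle (hmem y hy) (hmem z hz)
  push Not at hthree
  by_cases hedge : ∃ v u, G.Adj v u
  · obtain ⟨v, u, hvu⟩ := hedge
    obtain ⟨C, hC⟩ := hcolor (G.deleteEdges {s(v, u)}) (hlt hvu rfl)
    obtain ⟨a, ha, hva⟩ := hC.exists_color (hdeg (Nat.le_of_lt_succ (hthree v)) hvu rfl)
    obtain ⟨b, hb, hub⟩ := hC.exists_color
      (hdeg (Nat.le_of_lt_succ (hthree u)) hvu.symm (by rw [Sym2.eq_swap]; rfl))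
    obtain ⟨p, hp, hap, hbp⟩ : ∃ p < 3, a ≠ p ∧ b ≠ p := by
      have key : ∀ a b : Fin 3, ∃ p : Fin 3, a ≠ p ∧ b ≠ p := by decide
      obtain ⟨p, h⟩ := key ⟨a, ha⟩ ⟨b, hb⟩
      exact ⟨p, p.2, by simpa [Fin.ext_iff] using h⟩
    exact ⟨_, hC.insert_edge hp (fun y z hyz hne => deleteEdges_adj.2 ⟨hyz, hne⟩)
      (fun w hw => (hva w hw).trans_ne hap) fun w hw => (hub w hw).trans_ne hbp⟩
  · push Not at hedge
    exact ⟨fun _ => 0, ⟨fun v w h => absurd h (hedge v w), fun v w _ h => absurd h (hedge v w)⟩⟩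

/-- **Lemma (3-coloring).** If the vertices of a subcubic graph `G` can be partitioned into
sets `U` and `W` such that `G[W]` contains at most one edge and every vertex of `U` has
degree at most two, then `G` is 3-edge-colorable. -/
theorem stmt_7 {V : Type*} [Fintype V] (G : SimpleGraph V) [DecidableRel G.Adj]
    (hsub : ∀ v : V, G.degree v ≤ 3)
    (U W : Set V) (hUW : U ∪ W = Set.univ) (hdisj : Disjoint U W)
    (hW : {e ∈ G.edgeSet | ∀ v ∈ e, v ∈ W}.ncard ≤ 1)
    (hU : ∀ u ∈ U, G.degree u ≤ 2) :
    HasProperEdgeColoring G 3 := by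
  have hdeg : ∀ v, (G.neighborSet v).ncard = G.degree v := fun v => by
    rw [← card_neighborSet_eq_degree, ← Nat.card_eq_fintype_card]
    rfl
  have hmem : ∀ v, 3 ≤ (G.neighborSet v).ncard → v ∈ W := by
    intro v hv
    rcases hUW.symm ▸ Set.mem_univ v with hvU | hvW
    · have := hU v hvU
      have := hdeg v
      omega
    · exact hvW
  obtain ⟨C, hC⟩ := G.exists_isThreeEdgeColoring (fun v => (hdeg v).trans_le (hsub v)) <| by
    intro v y z hy hz hv' hy' hz'
    have hpair : ∀ w, G.Adj v w → 3 ≤ (G.neighborSet w).ncard →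
        s(v, w) ∈ {e ∈ G.edgeSet | ∀ v ∈ e, v ∈ W} := by
      intro w hw hw'
      refine ⟨hw, fun t ht => ?_⟩
      rcases Sym2.mem_iff.1 ht with rfl | rfl
      exacts [hmem _ hv', hmem _ hw']
    exact Sym2.congr_right.1
      ((Set.ncard_le_one (Set.toFinite _)).1 hW _ (hpair y hy hy') _ (hpair z hz hz'))
  exact hC.hasProperEdgeColoring
end

section
/- Let G be a subcubic simple graph and let K₂ have vertex set {a, b}. Let u, v, w be vertices of G with uv an edge of G, let e_a be the edge joining (u,a) and (v,a) in G □ K₂, and let f be the edge joining (w,a) and (w,b) in G □ K₂ (here w may or may not lie in {u,v}). Then every proper edge-precoloring of the edge set {e_a, f} with colors from a set of 4 colors can be extended to a proper edge-coloring of G □ K₂ with 4 colors. -/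
open SimpleGraph

/-- Any two edges of `H` that meet in a vertex get different colors under `C`. -/
def SimpleGraph.EdgeProper {V α : Type*} (H : SimpleGraph V) (C : Sym2 V → α) : Prop :=
  ∀ ⦃x y z⦄, H.Adj x y → H.Adj x z → y ≠ z → C s(x, y) ≠ C s(x, z)

/-- The color `k` does not occur at the vertex `v` under `C`. -/
def SimpleGraph.ColorMissing {V α : Type*} (H : SimpleGraph V) (C : Sym2 V → α) (v : V) (k : α) :
    Prop :=
  ∀ ⦃b⦄, H.Adj v b → C s(v, b) ≠ k

namespace SimpleGraph

variable {V α : Type*}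

theorem EdgeProper.mono {H H' : SimpleGraph V} {C : Sym2 V → α} (h : H ≤ H')
    (hC : H'.EdgeProper C) : H.EdgeProper C :=
  fun _ _ _ hy hz hne => hC (h hy) (h hz) hne

theorem ColorMissing.mono {H H' : SimpleGraph V} {C : Sym2 V → α} {v : V} {k : α} (h : H ≤ H')
    (hC : H'.ColorMissing C v k) : H.ColorMissing C v k :=
  fun _ hb => hC (h hb)

open Classical in
theorem EdgeProper.update {H : SimpleGraph V} {C : Sym2 V → α} {x y : V} {k : α}
    (hC : (H.deleteEdges {s(x, y)}).EdgeProper C)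
    (hx : (H.deleteEdges {s(x, y)}).ColorMissing C x k)
    (hy : (H.deleteEdges {s(x, y)}).ColorMissing C y k) :
    H.EdgeProper (Function.update C s(x, y) k) := by
  have key : ∀ ⦃a b c⦄, H.Adj a c → b ≠ c → s(a, b) = s(x, y) →
      s(a, c) ≠ s(x, y) ∧ C s(a, c) ≠ k := by
    intro a b c hac hbc he
    have hne : s(a, c) ≠ s(x, y) := by
      rw [← he]
      intro h
      exact hbc (Sym2.congr_right.1 h).symm
    have hac' : (H.deleteEdges {s(x, y)}).Adj a c := by
      rw [deleteEdges_adj]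
      exact ⟨hac, hne⟩
    refine ⟨hne, ?_⟩
    rcases Sym2.eq_iff.1 he with ⟨rfl, _⟩ | ⟨rfl, _⟩
    · exact hx hac'
    · exact hy hac'
  intro a b c hab hac hbc
  by_cases h1 : s(a, b) = s(x, y)
  · obtain ⟨h2, h3⟩ := key hac hbc h1
    rw [h1, Function.update_self, Function.update_of_ne h2]
    exact h3.symm
  · by_cases h2 : s(a, c) = s(x, y)
    · obtain ⟨_, h3⟩ := key hab hbc.symm h2
      rw [h2, Function.update_self, Function.update_of_ne h1]
      exact h3
    · rw [Function.update_of_ne h1, Function.update_of_ne h2]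
      exact hC (by rw [deleteEdges_adj]; exact ⟨hab, h1⟩)
        (by rw [deleteEdges_adj]; exact ⟨hac, h2⟩) hbc

/-- The subgraph formed by the edges with colors `β` and `γ`. -/
def kempeGraph (H : SimpleGraph V) (C : Sym2 V → α) (β γ : α) : SimpleGraph V where
  Adj a b := H.Adj a b ∧ (C s(a, b) = β ∨ C s(a, b) = γ)
  symm := ⟨fun a b h => by rw [Sym2.eq_swap]; exact ⟨h.1.symm, h.2⟩⟩
  loopless := ⟨fun a h => H.loopless.irrefl a h.1⟩

open Classical in
/-- Exchange the colors `β` and `γ` on the Kempe chain through `r`. -/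
noncomputable def kempeSwap (H : SimpleGraph V) (C : Sym2 V → α) (β γ : α) (r : V) :
    Sym2 V → α :=
  fun e => if ∃ v ∈ e, (H.kempeGraph C β γ).Reachable r v then Equiv.swap β γ (C e) else C e

open Classical in
theorem kempeSwap_apply {H : SimpleGraph V} (C : Sym2 V → α) (β γ : α) (r : V) {a b : V}
    (hab : H.Adj a b) :
    H.kempeSwap C β γ r s(a, b) =
      if (H.kempeGraph C β γ).Reachable r a then Equiv.swap β γ (C s(a, b)) else C s(a, b) := by
  unfold kempeSwap
  by_cases ha : (H.kempeGraph C β γ).Reachable r a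
  · rw [if_pos ⟨a, by simp, ha⟩, if_pos ha]
  rw [if_neg ha]
  split_ifs with h
  · obtain ⟨v, hv, hr⟩ := h
    rcases Sym2.mem_iff.1 hv with rfl | rfl
    · exact absurd hr ha
    · have : ¬ (C s(a, v) = β ∨ C s(a, v) = γ) := fun hc =>
        ha (hr.trans (Adj.reachable (G := H.kempeGraph C β γ) ⟨hab, hc⟩).symm)
      push Not at this
      exact Equiv.swap_apply_of_ne_of_ne this.1 this.2
  · rfl

theorem EdgeProper.kempeSwap {H : SimpleGraph V} {C : Sym2 V → α} (hC : H.EdgeProper C)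
    (β γ : α) (r : V) : H.EdgeProper (H.kempeSwap C β γ r) := by
  intro x y z hy hz hne
  rw [kempeSwap_apply C β γ r hy, kempeSwap_apply C β γ r hz]
  split_ifs
  · exact (Equiv.injective _).ne (hC hy hz hne)
  · exact hC hy hz hne

theorem ColorMissing.kempeSwap_of_not_reachable {H : SimpleGraph V} {C : Sym2 V → α} {β γ : α}
    {r v : V} {k : α} (h : H.ColorMissing C v k) (hv : ¬ (H.kempeGraph C β γ).Reachable r v) :
    H.ColorMissing (H.kempeSwap C β γ r) v k := by
  intro b hb
  rw [kempeSwap_apply C β γ r hb, if_neg hv]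
  exact h hb

theorem ColorMissing.kempeSwap_self {H : SimpleGraph V} {C : Sym2 V → α} {β γ : α} {r : V}
    (h : H.ColorMissing C r β) : H.ColorMissing (H.kempeSwap C β γ r) r γ := by
  classical
  intro b hb
  rw [kempeSwap_apply C β γ r hb, if_pos (Reachable.refl r)]
  intro h'
  rw [Equiv.swap_apply_eq_iff, Equiv.swap_apply_right] at h'
  exact h hb h'

theorem ColorMissing.kempeSwap_of_ne {H : SimpleGraph V} {C : Sym2 V → α} {β γ : α} {r v : V}
    {k : α} (h : H.ColorMissing C v k) (hβ : k ≠ β) (hγ : k ≠ γ) :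
    H.ColorMissing (H.kempeSwap C β γ r) v k := by
  classical
  intro b hb
  rw [kempeSwap_apply C β γ r hb]
  split_ifs
  · intro h'
    rw [Equiv.swap_apply_eq_iff, Equiv.swap_apply_of_ne_of_ne hβ hγ] at h'
    exact h hb h'
  · exact h hb

/-- In a graph of maximum degree two, no three vertices of degree at most one lie in the same
component. -/
theorem not_reachable_of_degree_le_one [Finite V] {K : SimpleGraph V}
    (h2 : ∀ v, (K.neighborSet v).ncard ≤ 2) {x y z : V} (hxy : x ≠ y) (hxz : x ≠ z) (hyz : y ≠ z)
    (hx : (K.neighborSet x).ncard ≤ 1) (hy : (K.neighborSet y).ncard ≤ 1)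
    (hz : (K.neighborSet z).ncard ≤ 1) (hyx : K.Reachable y x) : ¬ K.Reachable z x := by
  classical
  intro hzx
  have := Fintype.ofFinite V
  let c := K.connectedComponentMk x
  let L := K.induce c.supp
  have hL : L.Connected := c.connected_toSimpleGraph
  have hcard := hL.card_vert_le_card_edgeSet_add_one
  have hsum := L.sum_degrees_eq_twice_card_edges
  have hdeg : ∀ v : c.supp, L.degree v ≤ (K.neighborSet v).ncard := by
    intro v
    rw [← L.card_neighborSet_eq_degree v, ← Nat.card_eq_fintype_card, Nat.card_coe_set_eq]
    refine Set.ncard_le_ncard_of_injOn (fun a => (a : V)) (fun a ha => ?_)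
      (fun a _ b _ h => Subtype.ext h) (Set.toFinite _)
    exact ha
  let x' : c.supp := ⟨x, rfl⟩
  let y' : c.supp := ⟨y, ConnectedComponent.sound hyx⟩
  let z' : c.supp := ⟨z, ConnectedComponent.sound hzx⟩
  have hle : ∑ v : c.supp, (L.degree v + if v ∈ ({x', y', z'} : Finset c.supp) then 1 else 0)
      ≤ ∑ v : c.supp, 2 := by
    refine Finset.sum_le_sum fun v _ => ?_
    have := hdeg v
    have := h2 v
    split_ifs with h
    · simp only [Finset.mem_insert, Finset.mem_singleton] at h
      rcases h with rfl | rfl | rfl <;> simp only [x', y', z'] at * <;> omega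
    · omega
  have h3 : ({x', y', z'} : Finset c.supp).card = 3 :=
    Finset.card_eq_three.2 ⟨x', y', z', fun h => hxy (congrArg Subtype.val h), fun h => hxz (congrArg Subtype.val h),
      fun h => hyz (congrArg Subtype.val h), rfl⟩
  rw [Finset.sum_add_distrib, hsum, Finset.sum_boole, Finset.filter_mem_eq_inter,
    Finset.univ_inter, h3, Finset.sum_const, Finset.card_univ] at hle
  rw [Nat.card_eq_fintype_card, Nat.card_eq_fintype_card, ← edgeFinset_card] at hcard
  simp only [Nat.cast_ofNat, smul_eq_mul] at hle
  omega

theorem eq_of_ncard_le_one [Finite V] {H : SimpleGraph V} {v a b : V}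
    (h : (H.neighborSet v).ncard ≤ 1) (ha : H.Adj v a) (hb : H.Adj v b) : a = b :=
  (Set.ncard_le_one (Set.toFinite _)).1 h a ha b hb

theorem EdgeProper.ncard_kempeGraph_neighborSet_le {H : SimpleGraph V} {C : Sym2 V → α}
    (hC : H.EdgeProper C) (β γ : α) (v : V) :
    ((H.kempeGraph C β γ).neighborSet v).ncard ≤ 2 := by
  classical
  refine (Set.ncard_le_ncard_of_injOn (t := {β, γ}) (fun b => C s(v, b)) (fun b hb => ?_)
    (fun a ha b hb h => ?_) (Set.toFinite _)).trans ((Set.ncard_insert_le _ _).trans (by simp))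
  · exact hb.2
  · by_contra hne
    exact hC ha.1 hb.1 hne h

theorem EdgeProper.ncard_kempeGraph_neighborSet_le_one {H : SimpleGraph V} {C : Sym2 V → α}
    (hC : H.EdgeProper C) {β γ : α} {v : V} (h : H.ColorMissing C v β ∨ H.ColorMissing C v γ) :
    ((H.kempeGraph C β γ).neighborSet v).ncard ≤ 1 := by
  have hsub : ((H.kempeGraph C β γ).neighborSet v).Subsingleton := by
    intro a ha b hb
    by_contra hne
    have h1 := hC ha.1 hb.1 hne
    rcases h with h | h
    · exact h1 ((ha.2.resolve_left (h ha.1)).trans (hb.2.resolve_left (h hb.1)).symm)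
    · exact h1 ((ha.2.resolve_right (h ha.1)).trans (hb.2.resolve_right (h hb.1)).symm)
  exact (Set.ncard_le_one hsub.finite).2 fun _ ha _ hb => hsub ha hb

/-- Recolor `x y'` with a color missing at both of its ends, which frees its color for `x y`. -/
theorem exists_edgeProper_of_shift {H : SimpleGraph V} {x y y' : V} {C : Sym2 V → α} {γ : α}
    (hC : (H.deleteEdges {s(x, y)}).EdgeProper C) (hadj : H.Adj x y') (hyy' : y ≠ y')
    (hxy : x ≠ y)
    (hx : (H.deleteEdges {s(x, y)}).ColorMissing C x γ)
    (hy' : (H.deleteEdges {s(x, y)}).ColorMissing C y' γ)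
    (hy : (H.deleteEdges {s(x, y)}).ColorMissing C y (C s(x, y'))) :
    ∃ C : Sym2 V → α, H.EdgeProper C := by
  classical
  have hadj' : (H.deleteEdges {s(x, y)}).Adj x y' := by
    rw [deleteEdges_adj]
    refine ⟨hadj, fun h => hyy' ?_⟩
    exact (Sym2.congr_right.1 h).symm
  have hle : (H.deleteEdges {s(x, y)}).deleteEdges {s(x, y')} ≤ H.deleteEdges {s(x, y)} :=
    deleteEdges_le _
  refine ⟨_, EdgeProper.update (k := C s(x, y'))
    (EdgeProper.update (x := x) (y := y') (k := γ) (hC.mono hle) (hx.mono hle) (hy'.mono hle))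
    (fun b hb => ?_) (fun b hb => ?_)⟩
  · by_cases hby : b = y'
    · rw [hby, Function.update_self]
      exact (hx hadj').symm
    · rw [Function.update_of_ne (fun h => hby (Sym2.congr_right.1 h))]
      exact hC hb hadj' hby
  · rw [Function.update_of_ne]
    · exact hy hb
    · intro h
      rcases Sym2.eq_iff.1 h with ⟨h, _⟩ | ⟨h, _⟩
      · exact hxy h.symm
      · exact hyy' h

theorem ColorMissing.of_ncard_le_one [Finite V] {H : SimpleGraph V} {C : Sym2 V → α} {y b : V}
    (h : (H.neighborSet y).ncard ≤ 1) (hb : H.Adj y b) {k : α} (hk : C s(y, b) ≠ k) :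
    H.ColorMissing C y k := by
  intro a ha
  rwa [eq_of_ncard_le_one h ha hb]

theorem ncard_neighborSet_deleteEdges_lt [Finite V] {H : SimpleGraph V} {x y : V}
    (hxy : H.Adj x y) :
    ((H.deleteEdges {s(x, y)}).neighborSet x).ncard < (H.neighborSet x).ncard := by
  refine Set.ncard_lt_ncard ⟨fun a ha => deleteEdges_le _ ha, fun h => ?_⟩ (Set.toFinite _)
  have : (H.deleteEdges {s(x, y)}).Adj x y := h hxy
  simp [deleteEdges_adj] at this

theorem exists_edgeProper_of_deleteEdges_of_degree_three [Finite V] {H : SimpleGraph V}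
    {x y y' z : V} (hN : H.neighborSet x = {y, y', z}) (hyy' : y ≠ y') (hyz : y ≠ z)
    (hy'z : y' ≠ z)
    (hy : (H.neighborSet y).ncard ≤ 2) (hy' : (H.neighborSet y').ncard ≤ 2)
    {C : Sym2 V → Fin 3} (hC : (H.deleteEdges {s(x, y)}).EdgeProper C) :
    ∃ C : Sym2 V → Fin 3, H.EdgeProper C := by
  classical
  have hmem : ∀ b, H.Adj x b ↔ b = y ∨ b = y' ∨ b = z := fun b => by
    rw [← mem_neighborSet, hN]; simp
  have hxy : H.Adj x y := (hmem y).2 (by simp)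
  have hxy' : H.Adj x y' := (hmem y').2 (by simp)
  have hxz : H.Adj x z := (hmem z).2 (by simp)
  by_contra hcon
  set H' := H.deleteEdges {s(x, y)} with hH'
  have hno : ∀ {C : Sym2 V → Fin 3} {k}, H'.EdgeProper C → H'.ColorMissing C x k →
      ¬ H'.ColorMissing C y k := fun hC h1 h2 => hcon ⟨_, EdgeProper.update hC h1 h2⟩
  have hshift : ∀ {C : Sym2 V → Fin 3} {γ}, H'.EdgeProper C → H'.ColorMissing C x γ →
      H'.ColorMissing C y' γ → ¬ H'.ColorMissing C y (C s(x, y')) := fun hC h1 h2 h3 =>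
    hcon (exists_edgeProper_of_shift hC hxy' hyy' hxy.ne h1 h2 h3)
  have hmem' : ∀ b, H'.Adj x b ↔ b = y' ∨ b = z := by
    intro b
    rw [hH', deleteEdges_adj, hmem, Set.mem_singleton_iff, Sym2.congr_right]
    constructor
    · tauto
    · rintro (rfl | rfl)
      · exact ⟨by simp, hyy'.symm⟩
      · exact ⟨by simp, hyz.symm⟩
  have ha : H'.Adj x y' := (hmem' y').2 (by simp)
  have hb : H'.Adj x z := (hmem' z).2 (by simp)
  have hyH' : (H'.neighborSet y).ncard ≤ 1 := by
    have := ncard_neighborSet_deleteEdges_lt hxy.symm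
    rw [Sym2.eq_swap, ← hH'] at this
    omega
  have hαβ := hC ha hb hy'z
  obtain ⟨γ, hγα, hγβ⟩ : ∃ γ : Fin 3, γ ≠ C s(x, y') ∧ γ ≠ C s(x, z) := by
    generalize C s(x, y') = p
    generalize C s(x, z) = q
    revert p q
    decide
  set α' := C s(x, y') with hα'
  set β := C s(x, z) with hβ
  have hall : ∀ k : Fin 3, k = α' ∨ k = β ∨ k = γ := by omega
  have hxγ : H'.ColorMissing C x γ := by
    intro b hb
    rcases (hmem' b).1 hb with rfl | rfl
    · exact hγα.symm
    · exact hγβ.symm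
  obtain ⟨t, hyt, ht⟩ : ∃ t, H'.Adj y t ∧ C s(y, t) = γ := by
    have := hno hC hxγ
    unfold ColorMissing at this
    push Not at this
    exact this
  have hyα : H'.ColorMissing C y α' := .of_ncard_le_one hyH' hyt (by rw [ht]; exact hγα)
  have hyβ : H'.ColorMissing C y β := .of_ncard_le_one hyH' hyt (by rw [ht]; exact hγβ)
  obtain ⟨t', hyt', ht'⟩ : ∃ t, H'.Adj y' t ∧ C s(y', t) = γ := by
    have : ¬ H'.ColorMissing C y' γ := fun h => hshift hC hxγ h hyα
    unfold ColorMissing at this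
    push Not at this
    exact this
  have hy'β : H'.ColorMissing C y' β := by
    intro b hb hbβ
    have h3 : ({x, t', b} : Set V) ⊆ H.neighborSet y' := by
      rintro c (rfl | rfl | rfl)
      · exact hxy'.symm
      · exact deleteEdges_le _ hyt'
      · exact deleteEdges_le _ hb
    have hxt' : x ≠ t' := by
      rintro rfl
      rw [Sym2.eq_swap] at ht'
      exact hγα ht'.symm
    have hxb : x ≠ b := by
      rintro rfl
      rw [Sym2.eq_swap] at hbβ
      exact hαβ hbβ
    have htb : t' ≠ b := by
      rintro rfl
      exact hγβ (ht'.symm.trans hbβ)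
    have := Set.ncard_le_ncard h3 (Set.toFinite _)
    rw [Set.ncard_eq_three.2 ⟨x, t', b, hxt', hxb, htb, rfl⟩] at this
    omega
  by_cases hr : (H'.kempeGraph C β γ).Reachable y x
  · have hr' := not_reachable_of_degree_le_one (hC.ncard_kempeGraph_neighborSet_le β γ)
      hxy.ne hxy'.ne hyy' (hC.ncard_kempeGraph_neighborSet_le_one (.inr hxγ))
      (hC.ncard_kempeGraph_neighborSet_le_one (.inl hyβ))
      (hC.ncard_kempeGraph_neighborSet_le_one (.inl hy'β)) hr
    refine hshift (hC.kempeSwap β γ y') (hxγ.kempeSwap_of_not_reachable hr')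
      hy'β.kempeSwap_self ?_
    rw [kempeSwap_apply C β γ y' ha, if_neg hr']
    exact hyα.kempeSwap_of_ne hαβ hγα.symm
  · exact hno (hC.kempeSwap β γ y) (hxγ.kempeSwap_of_not_reachable hr) hyβ.kempeSwap_self

/-- A subcubic graph in which all edges between vertices of degree three pass through a fixed
vertex `w` has a proper `3`-edge-coloring. -/
theorem exists_edgeProper_fin_three [Finite V] (w : V) (H : SimpleGraph V)
    (h3 : ∀ v, (H.neighborSet v).ncard ≤ 3)
    (hw : ∀ a b, H.Adj a b → (H.neighborSet a).ncard = 3 → (H.neighborSet b).ncard = 3 →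
      a = w ∨ b = w) :
    ∃ C : Sym2 V → Fin 3, H.EdgeProper C := by
  classical
  induction H using WellFoundedLT.induction with
  | ind H ih =>
    have step : ∀ x y, H.Adj x y →
        ∃ C : Sym2 V → Fin 3, (H.deleteEdges {s(x, y)}).EdgeProper C := by
      intro x y hxy
      have hmono : ∀ v, ((H.deleteEdges {s(x, y)}).neighborSet v).ncard ≤
          (H.neighborSet v).ncard := fun v =>
        Set.ncard_le_ncard (fun a ha => deleteEdges_le _ ha) (Set.toFinite _)
      refine ih _ ?_ (fun v => (hmono v).trans (h3 v)) (fun a b hab ha hb => ?_)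
      · refine lt_of_le_of_ne (deleteEdges_le _) (fun h => ?_)
        have := hxy
        rw [← h] at this
        simp [deleteEdges_adj] at this
      · exact hw a b (deleteEdges_le _ hab) ((h3 a).antisymm (ha ▸ hmono a))
          ((h3 b).antisymm (hb ▸ hmono b))
    by_cases hex : ∃ x, (H.neighborSet x).ncard = 3
    · obtain ⟨x, hx, hnb⟩ : ∃ x, (H.neighborSet x).ncard = 3 ∧
          ∀ a, H.Adj x a → a ≠ w → (H.neighborSet a).ncard ≤ 2 := by
        by_cases hex' : ∃ x, x ≠ w ∧ (H.neighborSet x).ncard = 3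
        · obtain ⟨x, hxw, hx⟩ := hex'
          refine ⟨x, hx, fun a ha haw => ?_⟩
          have := h3 a
          by_contra hcon
          exact (hw x a ha hx (by omega)).elim hxw haw
        · obtain ⟨x, hx⟩ := hex
          refine ⟨x, hx, fun a ha haw => ?_⟩
          have := h3 a
          by_contra hcon
          exact hex' ⟨a, haw, by omega⟩
      obtain ⟨y, y', z, hN, h1, h2, h4, hyw, hy'w⟩ : ∃ y y' z, H.neighborSet x = {y, y', z} ∧
          y ≠ y' ∧ y ≠ z ∧ y' ≠ z ∧ y ≠ w ∧ y' ≠ w := by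
        obtain ⟨a, b, c, hab, hac, hbc, hN⟩ := Set.ncard_eq_three.1 hx
        by_cases ha : a = w
        · refine ⟨b, c, a, ?_, hbc, hab.symm, hac.symm, ha ▸ hab.symm, ha ▸ hac.symm⟩
          rw [hN]; ext; simp; tauto
        · by_cases hb : b = w
          · refine ⟨a, c, b, ?_, hac, hab, hbc.symm, ha, hb ▸ hbc.symm⟩
            rw [hN]; ext; simp; tauto
          · exact ⟨a, b, c, hN, hab, hac, hbc, ha, hb⟩
      have hxy : H.Adj x y := by rw [← mem_neighborSet, hN]; simp
      have hxy' : H.Adj x y' := by rw [← mem_neighborSet, hN]; simp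
      obtain ⟨C, hC⟩ := step x y hxy
      exact exists_edgeProper_of_deleteEdges_of_degree_three hN h1 h2 h4 (hnb y hxy hyw)
        (hnb y' hxy' hy'w) hC
    · by_cases hE : ∃ x y, H.Adj x y
      · obtain ⟨x, y, hxy⟩ := hE
        obtain ⟨C, hC⟩ := step x y hxy
        set H' := H.deleteEdges {s(x, y)} with hH'
        have hsmall : ∀ v, (H'.neighborSet v).ncard ≤ 1 →
            ∃ k, ∀ l, l ≠ k → H'.ColorMissing C v l := by
          intro v hv
          by_cases hb : ∃ b, H'.Adj v b
          · obtain ⟨b, hb⟩ := hb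
            exact ⟨C s(v, b), fun l hl => .of_ncard_le_one hv hb hl.symm⟩
          · exact ⟨0, fun l _ b hb' => absurd ⟨b, hb'⟩ hb⟩
        have hle : ∀ v, (H.neighborSet v).ncard ≤ 2 := fun v => by
          have := h3 v
          have : (H.neighborSet v).ncard ≠ 3 := fun h => hex ⟨v, h⟩
          omega
        have hx1 := ncard_neighborSet_deleteEdges_lt hxy
        have hy1 := ncard_neighborSet_deleteEdges_lt hxy.symm
        rw [Sym2.eq_swap (a := y), ← hH'] at hy1
        rw [← hH'] at hx1
        have := hle x
        have := hle y
        obtain ⟨p, hp⟩ := hsmall x (by omega)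
        obtain ⟨q, hq⟩ := hsmall y (by omega)
        obtain ⟨k, hkp, hkq⟩ : ∃ k : Fin 3, k ≠ p ∧ k ≠ q := by
          clear hp hq
          revert p q
          decide
        exact ⟨_, EdgeProper.update hC (hp k hkp) (hq k hkq)⟩
      · push Not at hE
        exact ⟨fun _ => 0, fun x y _ h => absurd h (hE x y)⟩

/-- Every vertex has at most one neighbor. -/
def AtMostOneNeighbor (M : SimpleGraph V) : Prop :=
  ∀ ⦃a b c⦄, M.Adj a b → M.Adj a c → b = c

theorem AtMostOneNeighbor.exists_maximal [Finite V] {M₀ A : SimpleGraph V}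
    (h₀ : M₀.AtMostOneNeighbor) (hA : M₀ ≤ A) :
    ∃ M : SimpleGraph V, M.AtMostOneNeighbor ∧ M₀ ≤ M ∧ M ≤ A ∧
      ∀ a b, A.Adj a b → (∃ c, M.Adj a c) ∨ ∃ c, M.Adj b c := by
  classical
  obtain ⟨M, hM₀, hM⟩ := (Set.toFinite {M : SimpleGraph V | M.AtMostOneNeighbor ∧ M ≤ A})
    |>.exists_le_maximal (show M₀ ∈ _ from ⟨h₀, hA⟩)
  refine ⟨M, hM.prop.1, hM₀, hM.prop.2, fun a b hab => ?_⟩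
  by_contra! hcon
  have hmem : M ⊔ edge a b ∈ {M : SimpleGraph V | M.AtMostOneNeighbor ∧ M ≤ A} := by
    refine ⟨fun p q r hq hr => ?_, sup_le hM.prop.2 ?_⟩
    · simp only [sup_adj, edge_adj] at hq hr
      rcases hq with hq | hq <;> rcases hr with hr | hr
      · exact hM.prop.1 hq hr
      · rcases hr.1 with ⟨rfl, _⟩ | ⟨rfl, _⟩
        · exact absurd hq (hcon.1 _)
        · exact absurd hq (hcon.2 _)
      · rcases hq.1 with ⟨rfl, _⟩ | ⟨rfl, _⟩
        · exact absurd hr (hcon.1 _)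
        · exact absurd hr (hcon.2 _)
      · grind
    · intro p q hpq
      rw [edge_adj] at hpq
      rcases hpq.1 with ⟨rfl, rfl⟩ | ⟨rfl, rfl⟩
      · exact hab
      · exact hab.symm
  have := hM.le_of_ge hmem le_sup_left
  exact hcon.1 b (this (Or.inr (by simp [edge_adj, hab.ne])))

/-- A matching that avoids `w` and meets enough edges is a color class of a proper
`4`-edge-coloring. -/
theorem AtMostOneNeighbor.exists_edgeProper [Finite V] {G M : SimpleGraph V}
    (h3 : ∀ v, (G.neighborSet v).ncard ≤ 3) (hM : M.AtMostOneNeighbor) (hMG : M ≤ G) (w : V)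
    (hmax : ∀ a b, G.Adj a b → a ≠ w → b ≠ w →
      (∃ c, M.Adj a c) ∨ (∃ c, M.Adj b c) ∨ (G.neighborSet a).ncard ≤ 2 ∨
        (G.neighborSet b).ncard ≤ 2) :
    ∃ C : Sym2 V → Fin 4, G.EdgeProper C ∧ ∀ a b, C s(a, b) = 3 ↔ M.Adj a b := by
  classical
  have hmono : ∀ v, ((G \ M).neighborSet v).ncard ≤ (G.neighborSet v).ncard := fun v =>
    Set.ncard_le_ncard (fun a ha => ha.1) (Set.toFinite _)
  have hsat : ∀ v, ((G \ M).neighborSet v).ncard = 3 → ∀ c, ¬ M.Adj v c := by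
    intro v hv c hc
    have : ((G \ M).neighborSet v).ncard < (G.neighborSet v).ncard :=
      Set.ncard_lt_ncard ⟨fun a ha => ha.1, fun h => (h (hMG hc)).2 hc⟩ (Set.toFinite _)
    have := h3 v
    omega
  obtain ⟨C, hC⟩ := exists_edgeProper_fin_three w (G \ M) (fun v => (hmono v).trans (h3 v)) (by
    intro a b hab ha hb
    by_contra! hcon
    have h1 := hmono a
    have h2 := hmono b
    rcases hmax a b hab.1 hcon.1 hcon.2 with ⟨c, hc⟩ | ⟨c, hc⟩ | h | h
    · exact hsat a ha c hc
    · exact hsat b hb c hc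
    · omega
    · omega)
  have hne : ∀ k : Fin 3, k.castSucc ≠ (3 : Fin 4) := by decide
  refine ⟨fun e => if e ∈ M.edgeSet then 3 else (C e).castSucc, fun x y z hy hz hyz => ?_,
    fun a b => ?_⟩
  · simp only [mem_edgeSet]
    split_ifs with h1 h2 h2
    · exact absurd (hM h1 h2) hyz
    · exact (hne _).symm
    · exact hne _
    · exact (Fin.castSucc_injective 3).ne (hC ⟨hy, h1⟩ ⟨hz, h2⟩ hyz)
  · simp only [mem_edgeSet]
    split_ifs with h
    · simp [h]
    · simp [h, hne]

theorem ncard_neighborSet_le_two_of_forall {G : SimpleGraph V} {u v w : V}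
    (h : ∀ x, G.Adj u x → x = v ∨ x = w) : (G.neighborSet u).ncard ≤ 2 := by
  refine (Set.ncard_le_ncard (t := {v, w}) (fun x hx => ?_) (Set.toFinite _)).trans
    ((Set.ncard_insert_le _ _).trans (by simp))
  simpa using h x hx

theorem edge_atMostOneNeighbor (u v : V) : (edge u v).AtMostOneNeighbor := by
  intro a b c hb hc
  simp only [edge_adj] at hb hc
  grind

theorem exists_edgeProper_colorMissing [Finite V] {G : SimpleGraph V}
    (h3 : ∀ v, (G.neighborSet v).ncard ≤ 3) {u v : V} (w : V) (huv : G.Adj u v) (p : Prop)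
    (hp : w = u ∨ w = v → ¬ p) :
    ∃ C : Sym2 V → Fin 4, G.EdgeProper C ∧ G.ColorMissing C w 3 ∧ (C s(u, v) = 3 ↔ p) := by
  classical
  suffices h : ∃ M : SimpleGraph V, M.AtMostOneNeighbor ∧ M ≤ G ∧ (∀ a, ¬ M.Adj w a) ∧
      (M.Adj u v ↔ p) ∧ ∀ a b, G.Adj a b → a ≠ w → b ≠ w →
      (∃ c, M.Adj a c) ∨ (∃ c, M.Adj b c) ∨ (G.neighborSet a).ncard ≤ 2 ∨
        (G.neighborSet b).ncard ≤ 2 by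
    obtain ⟨M, hM, hMG, hMw, hMp, hmax⟩ := h
    obtain ⟨C, hC, hC3⟩ := hM.exists_edgeProper h3 hMG w hmax
    exact ⟨C, hC, fun b _ h => hMw b ((hC3 w b).1 h), (hC3 u v).trans hMp⟩
  let A : SimpleGraph V :=
    { Adj := fun a b => G.Adj a b ∧ a ≠ w ∧ b ≠ w
      symm := ⟨fun a b h => ⟨h.1.symm, h.2.2, h.2.1⟩⟩
      loopless := ⟨fun a h => G.loopless.irrefl a h.1⟩ }
  have hedge : ∀ x, G.Adj u x → u ≠ w → x ≠ w → edge u x ≤ A := by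
    intro x hx huw hxw a b hab
    rw [edge_adj] at hab
    rcases hab.1 with ⟨rfl, rfl⟩ | ⟨rfl, rfl⟩
    · exact ⟨hx, huw, hxw⟩
    · exact ⟨hx.symm, hxw, huw⟩
  have hedge' : ∀ x, G.Adj u x → u ≠ w → x ≠ w → ∃ M : SimpleGraph V, M.AtMostOneNeighbor ∧
      M ≤ G ∧ (∀ a, ¬ M.Adj w a) ∧ M.Adj u x ∧ ∀ a b, G.Adj a b → a ≠ w → b ≠ w →
      (∃ c, M.Adj a c) ∨ (∃ c, M.Adj b c) ∨ (G.neighborSet a).ncard ≤ 2 ∨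
        (G.neighborSet b).ncard ≤ 2 := by
    intro x hx huw hxw
    obtain ⟨M, hM, hM₀, hMA, hmax⟩ :=
      (edge_atMostOneNeighbor u x).exists_maximal (hedge x hx huw hxw)
    refine ⟨M, hM, fun a b h => (hMA h).1, fun a h => (hMA h).2.1 rfl,
      hM₀ (by simp [edge_adj, hx.ne]), fun a b hab ha hb => ?_⟩
    rcases hmax a b ⟨hab, ha, hb⟩ with h | h
    · exact .inl h
    · exact .inr (.inl h)
  by_cases hpp : p
  · have hw : ¬ (w = u ∨ w = v) := fun h => hp h hpp
    push Not at hw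
    obtain ⟨M, hM, hMG, hMw, hMuv, hmax⟩ := hedge' v huv hw.1.symm hw.2.symm
    exact ⟨M, hM, hMG, hMw, by simp [hMuv, hpp], hmax⟩
  by_cases hx : u ≠ w ∧ ∃ x, G.Adj u x ∧ x ≠ v ∧ x ≠ w
  · obtain ⟨huw, x, hux, hxv, hxw⟩ := hx
    obtain ⟨M, hM, hMG, hMw, hMux, hmax⟩ := hedge' x hux huw hxw
    exact ⟨M, hM, hMG, hMw, by simp only [hpp, iff_false]; exact fun h => hxv (hM hMux h), hmax⟩
  have hu : u ≠ w → (G.neighborSet u).ncard ≤ 2 := by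
    intro huw
    refine ncard_neighborSet_le_two_of_forall (v := v) (w := w) fun x hux => ?_
    by_contra! hcon
    exact hx ⟨huw, x, hux, hcon⟩
  obtain ⟨M, hM, -, hMA, hmax⟩ := AtMostOneNeighbor.exists_maximal
    (M₀ := ⊥) (A := A.deleteEdges {s(u, v)}) (fun _ _ _ h => absurd h (by simp)) bot_le
  refine ⟨M, hM, fun a b h => (deleteEdges_le _ (hMA h)).1,
    fun a h => (deleteEdges_le _ (hMA h)).2.1 rfl, ?_, fun a b hab ha hb => ?_⟩
  · simp only [hpp, iff_false]
    intro h
    have := hMA h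
    simp [deleteEdges_adj] at this
  · by_cases he : s(a, b) = s(u, v)
    · rcases Sym2.eq_iff.1 he with ⟨rfl, rfl⟩ | ⟨rfl, rfl⟩
      · exact .inr (.inr (.inl (hu ha)))
      · exact .inr (.inr (.inr (hu hb)))
    · have hA : (A.deleteEdges {s(u, v)}).Adj a b := by
        rw [deleteEdges_adj]
        exact ⟨⟨hab, ha, hb⟩, he⟩
      rcases hmax a b hA with h | h
      · exact .inl h
      · exact .inr (.inl h)

theorem exists_colorMissing_of_ncard_lt [Finite V] [Fintype α] {H : SimpleGraph V}
    (C : Sym2 V → α) {v : V} (h : (H.neighborSet v).ncard < Fintype.card α) :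
    ∃ k, H.ColorMissing C v k := by
  classical
  by_contra! hcon
  unfold ColorMissing at hcon
  push Not at hcon
  have hle : (Set.univ : Set α).ncard ≤ (H.neighborSet v).ncard := by
    refine (Set.ncard_le_ncard (t := (fun b => C s(v, b)) '' H.neighborSet v) (fun k _ => ?_)
      (Set.toFinite _)).trans (Set.ncard_image_le (Set.toFinite _))
    obtain ⟨b, hb, hk⟩ := hcon k
    exact ⟨b, hb, hk⟩
  rw [Set.ncard_univ, Nat.card_eq_fintype_card] at hle
  omega

/-- A proper edge-coloring together with a missing color at every vertex colors the prism. -/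
theorem exists_properOn_prism {G : SimpleGraph V} {n : ℕ} {C : Sym2 V → Fin n}
    (hC : G.EdgeProper C) {m : V → Fin n} (hm : ∀ v, G.ColorMissing C v (m v)) :
    ∃ D : Sym2 (V × Fin 2) → ℕ, (∀ e, D e < n) ∧
      ProperOn (G □ (⊤ : SimpleGraph (Fin 2))).edgeSet D ∧
      (∀ a b i j, G.Adj a b → D s((a, i), (b, j)) = C s(a, b)) ∧
      ∀ a i j, D s((a, i), (a, j)) = m a := by
  classical
  let D : Sym2 (V × Fin 2) → ℕ := Sym2.lift
    ⟨fun p q => if p.1 = q.1 then (m p.1 : ℕ) else (C s(p.1, q.1) : ℕ), fun p q => by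
      by_cases h : p.1 = q.1
      · simp [h]
      · simp only [if_neg h, if_neg (Ne.symm h), Sym2.eq_swap]⟩
  have hD : ∀ p q, D s(p, q) =
      if p.1 = q.1 then (m p.1 : ℕ) else (C s(p.1, q.1) : ℕ) := fun _ _ => rfl
  refine ⟨D, fun e => ?_, ?_, fun a b i j hab => ?_, fun a i j => ?_⟩
  · induction e with
    | _ p q =>
      rw [hD]
      split_ifs
      · exact (m p.1).2
      · exact (C s(p.1, q.1)).2
  · rintro e he f hf hef ⟨p, hpe, hpf⟩
    obtain ⟨q, rfl⟩ := hpe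
    obtain ⟨r, rfl⟩ := hpf
    have hqr : q ≠ r := fun h => hef (h ▸ rfl)
    rw [mem_edgeSet, boxProd_adj] at he hf
    rw [hD, hD]
    rcases he with ⟨he, heq⟩ | ⟨he, heq⟩ <;> rcases hf with ⟨hf, hfq⟩ | ⟨hf, hfq⟩
    · rw [if_neg he.ne, if_neg hf.ne, Ne, Fin.val_inj]
      exact hC he hf fun h => hqr (Prod.ext h (heq.symm.trans hfq))
    · rw [if_neg he.ne, if_pos hfq, Ne, Fin.val_inj]
      exact hm _ he
    · rw [if_neg hf.ne, if_pos heq, Ne, Fin.val_inj]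
      exact (hm _ hf).symm
    · refine absurd (Prod.ext (heq.symm.trans hfq) ?_) hqr
      rw [top_adj] at he hf
      omega
  · rw [hD, if_neg hab.ne]
  · rw [hD, if_pos rfl]

end SimpleGraph

theorem Equiv.Perm.exists_apply_eq_and_apply_eq {α : Type*} {a b c d : α} (h : a = b ↔ c = d) :
    ∃ π : Equiv.Perm α, π a = c ∧ π b = d := by
  classical
  refine ⟨(Equiv.swap a c).trans (Equiv.swap (Equiv.swap a c b) d), ?_, by simp⟩
  by_cases hab : a = b
  · obtain rfl := hab
    simp [h.1 rfl]
  · have hcd : c ≠ d := fun hcd => hab (h.2 hcd)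
    have : c ≠ Equiv.swap a c b := by
      intro hc
      rw [eq_comm, Equiv.swap_apply_eq_iff, Equiv.swap_apply_right] at hc
      exact hab hc.symm
    simp [Equiv.swap_apply_of_ne_of_ne this hcd]

/-- **Lemma (two edges, 4 colors).** Let `G` be subcubic, `uv ∈ E(G)`, `e_a` the copy of `uv`
in the `a`-copy of `G` inside `G □ K₂` and `f` the vertical edge at `w` (where `w` may or may
not lie in `{u, v}`).  Any proper precoloring of `{e_a, f}` from 4 colors extends to a proper
4-edge-coloring of `G □ K₂`. Here `K₂ = ⊤` on `Fin 2` with `a = 0`, `b = 1`. -/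
theorem stmt_8 {V : Type*} [Fintype V] (G : SimpleGraph V) [DecidableRel G.Adj]
    (hsub : ∀ v : V, G.degree v ≤ 3)
    (u v w : V) (huv : G.Adj u v)
    (ce cf : ℕ) (hce : ce < 4) (hcf : cf < 4)
    (hproper : w = u ∨ w = v → ce ≠ cf) :
    ∃ C : Sym2 (V × Fin 2) → ℕ,
      (∀ e ∈ (G □ (⊤ : SimpleGraph (Fin 2))).edgeSet, C e < 4) ∧
      ProperOn (G □ (⊤ : SimpleGraph (Fin 2))).edgeSet C ∧
      C s((u, 0), (v, 0)) = ce ∧ C s((w, 0), (w, 1)) = cf := by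
  classical
  have h3 : ∀ x, (G.neighborSet x).ncard ≤ 3 := fun x => by
    rw [← Nat.card_coe_set_eq, Nat.card_eq_fintype_card, card_neighborSet_eq_degree]
    exact hsub x
  obtain ⟨C, hC, hCw, hCp⟩ := exists_edgeProper_colorMissing h3 w huv (ce = cf) hproper
  obtain ⟨π, hπe, hπf⟩ := Equiv.Perm.exists_apply_eq_and_apply_eq
    (a := C s(u, v)) (b := 3) (c := (⟨ce, hce⟩ : Fin 4)) (d := ⟨cf, hcf⟩) (by simpa using hCp)
  have hmiss : ∀ x, ∃ k, G.ColorMissing C x k ∧ (x = w → k = 3) := by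
    intro x
    by_cases hx : x = w
    · exact ⟨3, hx ▸ hCw, fun _ => rfl⟩
    · obtain ⟨k, hk⟩ := exists_colorMissing_of_ncard_lt C
        (show (G.neighborSet x).ncard < Fintype.card (Fin 4) by
          have := h3 x
          simp only [Fintype.card_fin]
          omega)
      exact ⟨k, hk, fun h => absurd h hx⟩
  choose m hm hmw using hmiss
  obtain ⟨D, hD, hDp, hDe, hDf⟩ := exists_properOn_prism (G := G) (C := fun e => π (C e))
    (m := fun x => π (m x)) (fun x y z hy hz hne => π.injective.ne (hC hy hz hne))
    (fun x b hb => π.injective.ne (hm x hb))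
  refine ⟨D, fun e _ => hD e, hDp, ?_, ?_⟩
  · rw [hDe u v 0 0 huv, hπe]
  · rw [hDf w 0 1, hmw w rfl, hπf]
end
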